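/- arXiv:2202.10009 — 2 statements merged into one kernel-verified Lean document; each statement's English description precedes it below -/
import Mathlib

section
/- The following are equivalent for a variety V: (1) V has a difference term; (2) V has a Taylor term and the commutator is commutative throughout V (i.e., [x,y] = [y,x] for all congruences x, y on every algebra in V); (3) V has a Taylor term and the commutator is commutative on pairs of comparable congruences (i.e., [x,y] = [y,x] whenever x ≤ y in Con(A) for A ∈ V). -/
/-- A (universal-algebraic) signature: a type of operation symbols with arities. -/
structure Sig where
  ops : Type
  arity : ops → ℕ

/-- An algebra for a signature: a carrier set with an interpretation of each
operation symbol. -/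
structure Alg (σ : Sig) where
  carrier : Type
  interp : ∀ f : σ.ops, (Fin (σ.arity f) → carrier) → carrier

/-- Terms over a signature with variables from `V`. -/
inductive Trm (σ : Sig) (V : Type) : Type
  | var : V → Trm σ V
  | op : (f : σ.ops) → (Fin (σ.arity f) → Trm σ V) → Trm σ V

/-- Evaluation of a term in an algebra under an assignment of the variables. -/
def Alg.evalTrm {σ : Sig} (A : Alg σ) {V : Type} (asg : V → A.carrier) :
    Trm σ V → A.carrier
  | .var v => asg v
  | .op f ts => A.interp f fun i => A.evalTrm asg (ts i)

/-- A congruence on an algebra: an equivalence relation compatible with the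
basic operations. -/
structure Congruence {σ : Sig} (A : Alg σ) where
  rel : A.carrier → A.carrier → Prop
  iseqv : Equivalence rel
  compat : ∀ (f : σ.ops) (a b : Fin (σ.arity f) → A.carrier),
    (∀ i, rel (a i) (b i)) → rel (A.interp f a) (A.interp f b)

namespace Congruence

variable {σ : Sig} {A : Alg σ}

theorem ext' {c d : Congruence A} (h : c.rel = d.rel) : c = d := by
  cases c; cases d; cases h; rfl

instance : PartialOrder (Congruence A) where
  le c d := ∀ a b, c.rel a b → d.rel a b
  le_refl c a b h := h
  le_trans c d e h1 h2 a b h := h2 a b (h1 a b h)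
  le_antisymm c d h1 h2 :=
    ext' (funext fun a => funext fun b => propext ⟨h1 a b, h2 a b⟩)

instance : InfSet (Congruence A) where
  sInf S :=
    { rel := fun a b => ∀ c ∈ S, c.rel a b
      iseqv := ⟨fun a c _ => c.iseqv.refl a,
                fun h c hc => c.iseqv.symm (h c hc),
                fun h1 h2 c hc => c.iseqv.trans (h1 c hc) (h2 c hc)⟩
      compat := fun f a b h c hc => c.compat f a b fun i => h i c hc }

/-- The congruences of an algebra form a complete lattice (`⊥` is the equality
congruence, `⊤` is the total congruence, meet is intersection). -/
instance : CompleteLattice (Congruence A) :=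
  completeLatticeOfInf _ fun S =>
    ⟨fun c hc a b h => h c hc, fun c hc a b h d hd => hc hd a b h⟩

end Congruence

/-- `Centralizes S T δ` is the centralizer relation `C(S,T;δ)`: for every
`S,T`-matrix `[[p,q],[r,s]]` (built from a term operation `t`, tuples `a S b`
and `u T v`), if `(p,q) ∈ δ` then `(r,s) ∈ δ`. -/
def Centralizes {σ : Sig} {A : Alg σ} (S T δ : Congruence A) : Prop :=
  ∀ (m n : ℕ) (t : Trm σ (Sum (Fin m) (Fin n)))
    (a b : Fin m → A.carrier) (u v : Fin n → A.carrier),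
    (∀ i, S.rel (a i) (b i)) → (∀ j, T.rel (u j) (v j)) →
    δ.rel (A.evalTrm (Sum.elim a u) t) (A.evalTrm (Sum.elim a v) t) →
    δ.rel (A.evalTrm (Sum.elim b u) t) (A.evalTrm (Sum.elim b v) t)

/-- The commC `[S,T]`: the least congruence `δ` with `C(S,T;δ)`. -/
def commC {σ : Sig} {A : Alg σ} (S T : Congruence A) : Congruence A :=
  sInf {δ | Centralizes S T δ}

/-- The relative commC `[S,T]_ε`: the intersection of all congruences
`γ ≥ ε` with `C(S,T;γ)`. -/
def relCommC {σ : Sig} {A : Alg σ} (S T ε : Congruence A) : Congruence A :=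
  sInf {γ | ε ≤ γ ∧ Centralizes S T γ}

/-- The congruence generated by a single pair `(x, y)`. -/
def cgPair {σ : Sig} (A : Alg σ) (x y : A.carrier) : Congruence A :=
  sInf {c | c.rel x y}

/-- Homomorphisms of algebras. -/
structure UAHom {σ : Sig} (A B : Alg σ) where
  toFun : A.carrier → B.carrier
  map_op : ∀ (f : σ.ops) (a : Fin (σ.arity f) → A.carrier),
    toFun (A.interp f a) = B.interp f (fun i => toFun (a i))

/-- The product of a family of algebras. -/
def prodAlg {σ : Sig} {I : Type} (F : I → Alg σ) : Alg σ where
  carrier := ∀ i, (F i).carrier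
  interp f a := fun i => (F i).interp f (fun j => a j i)

/-- A variety: a class of algebras of a fixed signature closed under
homomorphic images, subalgebras (here: isomorphic copies of subalgebras,
i.e. sources of injective homomorphisms), and arbitrary products. -/
structure Variety (σ : Sig) where
  Mem : Alg σ → Prop
  closed_hom : ∀ {A B : Alg σ}, Mem A →
    (∃ h : UAHom A B, Function.Surjective h.toFun) → Mem B
  closed_sub : ∀ {A B : Alg σ}, Mem A →
    (∃ h : UAHom B A, Function.Injective h.toFun) → Mem B
  closed_prod : ∀ {I : Type} (F : I → Alg σ), (∀ i, Mem (F i)) → Mem (prodAlg F)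

/-- The setoid associated with a congruence. -/
def Congruence.setoid {σ : Sig} {A : Alg σ} (c : Congruence A) :
    Setoid A.carrier := ⟨c.rel, c.iseqv⟩

/-- The quotient algebra of an algebra by a congruence. -/
noncomputable def quotAlg {σ : Sig} (A : Alg σ) (c : Congruence A) : Alg σ where
  carrier := Quotient c.setoid
  interp f a := Quotient.mk c.setoid (A.interp f fun i => (a i).out)

/-- `algOn A α` is the algebra `A(α)`: the subalgebra of `A × A` whose
universe is `α`. -/
def algOn {σ : Sig} (A : Alg σ) (α : Congruence A) : Alg σ where
  carrier := {p : A.carrier × A.carrier // α.rel p.1 p.2}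
  interp f a := ⟨(A.interp f fun i => (a i).1.1, A.interp f fun i => (a i).1.2),
    α.compat f _ _ fun i => (a i).2⟩

/-- The kernel of the first coordinate projection of `A(α)`. -/
def eta1 {σ : Sig} (A : Alg σ) (α : Congruence A) : Congruence (algOn A α) where
  rel p q := p.1.1 = q.1.1
  iseqv := ⟨fun _ => rfl, Eq.symm, Eq.trans⟩
  compat f a b h := congrArg (A.interp f) (funext h)

/-- The kernel of the second coordinate projection of `A(α)`. -/
def eta2 {σ : Sig} (A : Alg σ) (α : Congruence A) : Congruence (algOn A α) where
  rel p q := p.1.2 = q.1.2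
  iseqv := ⟨fun _ => rfl, Eq.symm, Eq.trans⟩
  compat f a b h := congrArg (A.interp f) (funext h)

/-- The congruence `Δ_{α,β}` on `A(α)` generated by the `β`-diagonal pairs. -/
def diagDelta {σ : Sig} (A : Alg σ) (α β : Congruence A) :
    Congruence (algOn A α) :=
  sInf {c | ∀ x z : A.carrier, β.rel x z →
    c.rel ⟨(x, x), α.iseqv.refl x⟩ ⟨(z, z), α.iseqv.refl z⟩}

/-- A pentagon (five-element sublattice isomorphic to `N₅`) in the congruence
lattice with bottom `z`, side element `β`, critical chain `δ < θ`, and top `α`. -/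
def IsPentagon {σ : Sig} {A : Alg σ} (z β δ θ α : Congruence A) : Prop :=
  δ < θ ∧ β ⊓ θ = z ∧ β ⊓ δ = z ∧ β ⊔ δ = α ∧ β ⊔ θ = α

/-- Two congruences permute: `c ∘ d = d ∘ c`. -/
def Permutes {σ : Sig} {A : Alg σ} (c d : Congruence A) : Prop :=
  ∀ a b : A.carrier, (∃ x, c.rel a x ∧ d.rel x b) ↔ (∃ x, d.rel a x ∧ c.rel x b)

/-- `T` is a Taylor term for the variety `V`: an idempotent term satisfying an
`i`-th place Taylor identity for every place `i`. -/
def IsTaylorTrm {σ : Sig} (V : Variety σ) {n : ℕ} (T : Trm σ (Fin n)) : Prop :=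
  0 < n ∧
  (∀ A : Alg σ, V.Mem A → ∀ c : A.carrier, A.evalTrm (fun _ => c) T = c) ∧
  (∀ i : Fin n, ∃ w z : Fin n → Bool, w i ≠ z i ∧
    ∀ A : Alg σ, V.Mem A → ∀ x y : A.carrier,
      A.evalTrm (fun j => cond (w j) x y) T = A.evalTrm (fun j => cond (z j) x y) T)

/-- `V` has a Taylor term. -/
def HasTaylorTrm {σ : Sig} (V : Variety σ) : Prop :=
  ∃ (n : ℕ) (T : Trm σ (Fin n)), IsTaylorTrm V T

/-- A congruence is abelian if `[α,α] = 0`. -/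
def IsAbelianCong {σ : Sig} {A : Alg σ} (α : Congruence A) : Prop :=
  commC α α = ⊥

/-- `d` is a weak difference term for `V`: `d(a,a,b) = b` and `d(a,b,b) = a`
whenever the pair `(a,b)` lies in an abelian congruence of a member of `V`. -/
def IsWeakDifferenceTrm {σ : Sig} (V : Variety σ) (d : Trm σ (Fin 3)) : Prop :=
  ∀ A : Alg σ, V.Mem A → ∀ α : Congruence A, IsAbelianCong α →
    ∀ a b : A.carrier, α.rel a b →
      A.evalTrm ![a, a, b] d = b ∧ A.evalTrm ![a, b, b] d = a

/-- `d` is a difference term for `V`: `V ⊨ d(x,x,y) ≈ y` and `d(a,b,b) = a`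
whenever the pair `(a,b)` lies in an abelian congruence of a member of `V`. -/
def IsDifferenceTrm {σ : Sig} (V : Variety σ) (d : Trm σ (Fin 3)) : Prop :=
  (∀ A : Alg σ, V.Mem A → ∀ a b : A.carrier, A.evalTrm ![a, a, b] d = b) ∧
  (∀ A : Alg σ, V.Mem A → ∀ α : Congruence A, IsAbelianCong α →
    ∀ a b : A.carrier, α.rel a b → A.evalTrm ![a, b, b] d = a)

/-- The commC is left distributive throughout `V`. -/
def CommLeftDistrib {σ : Sig} (V : Variety σ) : Prop :=
  ∀ A : Alg σ, V.Mem A → ∀ x y z : Congruence A,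
    commC (x ⊔ y) z = commC x z ⊔ commC y z

/-- The commC is right distributive throughout `V`. -/
def CommRightDistrib {σ : Sig} (V : Variety σ) : Prop :=
  ∀ A : Alg σ, V.Mem A → ∀ x y z : Congruence A,
    commC x (y ⊔ z) = commC x y ⊔ commC x z

/-- The commC is commutative throughout `V`. -/
def CommutativeCommutator {σ : Sig} (V : Variety σ) : Prop :=
  ∀ A : Alg σ, V.Mem A → ∀ x y : Congruence A, commC x y = commC y x

/-- `V` is congruence modular. -/
def CongruenceModular {σ : Sig} (V : Variety σ) : Prop :=
  ∀ A : Alg σ, V.Mem A → IsModularLattice (Congruence A)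


namespace UA

variable {σ : Sig}

def _root_.Trm.bind {X Y : Type} (s : X → Trm σ Y) : Trm σ X → Trm σ Y
  | .var v => s v
  | .op f ts => .op f fun i => (ts i).bind s

theorem eval_bind (A : Alg σ) {X Y : Type} (s : X → Trm σ Y) (asg : Y → A.carrier)
    (t : Trm σ X) :
    A.evalTrm asg (t.bind s) = A.evalTrm (fun i => A.evalTrm asg (s i)) t := by
  induction t with
  | var v => rfl
  | op f ts ih => simp only [Trm.bind, Alg.evalTrm, ih]

theorem eval_var (A : Alg σ) {X : Type} (asg : X → A.carrier) (v : X) :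
    A.evalTrm asg (Trm.var v) = asg v := rfl

theorem hom_eval {A B : Alg σ} (h : UAHom A B) {X : Type} (asg : X → A.carrier) (t : Trm σ X) :
    h.toFun (A.evalTrm asg t) = B.evalTrm (fun i => h.toFun (asg i)) t := by
  induction t with
  | var v => rfl
  | op f ts ih => simp only [Alg.evalTrm, h.map_op, ih]

theorem cong_eval {A : Alg σ} (c : Congruence A) {X : Type} {a b : X → A.carrier}
    (h : ∀ i, c.rel (a i) (b i)) (t : Trm σ X) : c.rel (A.evalTrm a t) (A.evalTrm b t) := by
  induction t with
  | var v => exact h v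
  | op f ts ih => exact c.compat f _ _ ih

/-- every term is a renaming of a term in finitely many variables -/
theorem fin_support {X : Type} (t : Trm σ X) :
    ∃ (n : ℕ) (s : Trm σ (Fin n)) (e : Fin n → X), t = s.bind (fun i => Trm.var (e i)) := by
  induction t with
  | var v => exact ⟨1, Trm.var 0, fun _ => v, rfl⟩
  | op f ts ih =>
    choose n s e h using ih
    let E := Fintype.equivFin (Σ i, Fin (n i))
    refine ⟨_, Trm.op f (fun i => (s i).bind (fun j => Trm.var (E ⟨i, j⟩))),
      fun k => e (E.symm k).1 (E.symm k).2, ?_⟩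
    have bb : ∀ {X Y Z : Type} (u : X → Trm σ Y) (v : Y → Trm σ Z) (t : Trm σ X),
        (t.bind u).bind v = t.bind (fun i => (u i).bind v) := by
      intro X Y Z u v t
      induction t with
      | var v => rfl
      | op f ts ih => simp only [Trm.bind, ih]
    simp only [Trm.bind, bb]
    congr 1
    funext i
    rw [h i]
    congr 1
    funext j
    show Trm.var (e i j) =
      Trm.var ((fun k : Σ i, Fin (n i) => e k.1 k.2) (E.symm (E ⟨i, j⟩)))
    rw [Equiv.symm_apply_apply]

/-- Matrices -/
inductive Mat {A : Alg σ} (S T : Congruence A) :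
    A.carrier → A.carrier → A.carrier → A.carrier → Prop
  | vert {a b} : S.rel a b → Mat S T a a b b
  | horiz {u v} : T.rel u v → Mat S T u v u v
  | op (f : σ.ops) (p q r s : Fin (σ.arity f) → A.carrier) :
      (∀ i, Mat S T (p i) (q i) (r i) (s i)) →
      Mat S T (A.interp f p) (A.interp f q) (A.interp f r) (A.interp f s)

theorem Mat.eval {A : Alg σ} {S T : Congruence A} {X : Type} {p q r s : X → A.carrier}
    (h : ∀ i, Mat S T (p i) (q i) (r i) (s i)) (t : Trm σ X) :
    Mat S T (A.evalTrm p t) (A.evalTrm q t) (A.evalTrm r t) (A.evalTrm s t) := by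
  induction t with
  | var v => exact h v
  | op f ts ih => exact Mat.op f _ _ _ _ ih

theorem Mat.const {A : Alg σ} {S T : Congruence A} (a : A.carrier) : Mat S T a a a a :=
  Mat.vert (S.iseqv.refl a)

theorem Mat.form {A : Alg σ} {S T : Congruence A} {p q r s : A.carrier} (h : Mat S T p q r s) :
    ∃ (m n : ℕ) (t : Trm σ (Sum (Fin m) (Fin n)))
    (a b : Fin m → A.carrier) (u v : Fin n → A.carrier),
    (∀ i, S.rel (a i) (b i)) ∧ (∀ j, T.rel (u j) (v j)) ∧
    p = A.evalTrm (Sum.elim a u) t ∧ q = A.evalTrm (Sum.elim a v) t ∧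
    r = A.evalTrm (Sum.elim b u) t ∧ s = A.evalTrm (Sum.elim b v) t := by
  have key : ∃ (ι : Type) (t : Trm σ ι) (p' q' r' s' : ι → A.carrier),
      (∀ i, (p' i = q' i ∧ r' i = s' i ∧ S.rel (p' i) (r' i)) ∨
        (p' i = r' i ∧ q' i = s' i ∧ T.rel (p' i) (q' i))) ∧
      p = A.evalTrm p' t ∧ q = A.evalTrm q' t ∧ r = A.evalTrm r' t ∧ s = A.evalTrm s' t := by
    induction h with
    | @vert a b h => exact ⟨Unit, Trm.var (), fun _ => a, fun _ => a, fun _ => b, fun _ => b,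
        fun _ => Or.inl ⟨rfl, rfl, h⟩, rfl, rfl, rfl, rfl⟩
    | @horiz u v h => exact ⟨Unit, Trm.var (), fun _ => u, fun _ => v, fun _ => u, fun _ => v,
        fun _ => Or.inr ⟨rfl, rfl, h⟩, rfl, rfl, rfl, rfl⟩
    | op f p q r s _ ih =>
      choose ι t p' q' r' s' h hp hq hr hs using ih
      refine ⟨Σ i, ι i, Trm.op f (fun i => (t i).bind (fun j => Trm.var ⟨i, j⟩)),
        fun k => p' k.1 k.2, fun k => q' k.1 k.2, fun k => r' k.1 k.2, fun k => s' k.1 k.2,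
        fun k => h k.1 k.2, ?_, ?_, ?_, ?_⟩ <;>
      · simp only [Alg.evalTrm, eval_bind]
        congr 1
        funext i
        first | exact hp i | exact hq i | exact hr i | exact hs i
  clear h
  obtain ⟨ι, t, p', q', r', s', h, rfl, rfl, rfl, rfl⟩ := key
  obtain ⟨n, t, e, rfl⟩ := fin_support t
  classical
  refine ⟨n, n, t.bind (fun j => if p' (e j) = q' (e j) ∧ r' (e j) = s' (e j) ∧
    S.rel (p' (e j)) (r' (e j)) then Trm.var (Sum.inl j) else Trm.var (Sum.inr j)),
    fun j => p' (e j), fun j => if S.rel (p' (e j)) (r' (e j)) then r' (e j) else p' (e j),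
    fun j => p' (e j), fun j => if T.rel (p' (e j)) (q' (e j)) then q' (e j) else p' (e j),
    ?_, ?_, ?_, ?_, ?_, ?_⟩
  · intro i
    dsimp only
    split_ifs with h
    · exact h
    · exact S.iseqv.refl _
  · intro i
    dsimp only
    split_ifs with h
    · exact h
    · exact T.iseqv.refl _
  all_goals
    simp only [eval_bind]
    congr 1
    funext j
    have := h (e j)
    simp only [eval_var]
    split_ifs with h1
    · simp only [eval_var, Sum.elim_inl, if_pos h1.2.2]
      try first | exact h1.1.symm | exact h1.2.1.symm
    · have h2 := this.resolve_left h1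
      simp only [eval_var, Sum.elim_inr, if_pos h2.2.2]
      try first | exact h2.1.symm | exact h2.2.1.symm

theorem centralizes_iff {A : Alg σ} {S T δ : Congruence A} :
    Centralizes S T δ ↔ ∀ p q r s, Mat S T p q r s → δ.rel p q → δ.rel r s := by
  constructor
  · intro h p q r s hm
    obtain ⟨m, n, t, a, b, u, v, hab, huv, rfl, rfl, rfl, rfl⟩ := hm.form
    exact h m n t a b u v hab huv
  · intro h m n t a b u v hab huv
    refine h _ _ _ _ (Mat.eval ?_ t)
    rintro (i | j)
    · exact Mat.vert (hab i)
    · exact Mat.horiz (huv j)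

theorem Mat.mono {A : Alg σ} {S T S' T' : Congruence A} (hS : S ≤ S') (hT : T ≤ T')
    {p q r s : A.carrier} (h : Mat S T p q r s) : Mat S' T' p q r s := by
  induction h with
  | vert h => exact .vert (hS _ _ h)
  | horiz h => exact .horiz (hT _ _ h)
  | op f p q r s _ ih => exact .op f _ _ _ _ ih

theorem Mat.left {A : Alg σ} {S T : Congruence A}
    {p q r s : A.carrier} (h : Mat S T p q r s) : S.rel p r := by
  induction h with
  | vert h => exact h
  | horiz h => exact S.iseqv.refl _
  | op f p q r s _ ih => exact S.compat f _ _ ih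

theorem Mat.right {A : Alg σ} {S T : Congruence A}
    {p q r s : A.carrier} (h : Mat S T p q r s) : S.rel q s := by
  induction h with
  | vert h => exact h
  | horiz h => exact S.iseqv.refl _
  | op f p q r s _ ih => exact S.compat f _ _ ih

theorem Mat.top {A : Alg σ} {S T : Congruence A}
    {p q r s : A.carrier} (h : Mat S T p q r s) : T.rel p q := by
  induction h with
  | vert h => exact T.iseqv.refl _
  | horiz h => exact h
  | op f p q r s _ ih => exact T.compat f _ _ ih

theorem Mat.bot {A : Alg σ} {S T : Congruence A}
    {p q r s : A.carrier} (h : Mat S T p q r s) : T.rel r s := by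
  induction h with
  | vert h => exact T.iseqv.refl _
  | horiz h => exact h
  | op f p q r s _ ih => exact T.compat f _ _ ih

theorem Mat.flip {A : Alg σ} {S T : Congruence A}
    {p q r s : A.carrier} (h : Mat S T p q r s) : Mat T S p r q s := by
  induction h with
  | vert h => exact .horiz h
  | horiz h => exact .vert h
  | op f p q r s _ ih => exact .op f _ _ _ _ ih

theorem Mat.map {A B : Alg σ} {S T : Congruence A} {S' T' : Congruence B} (h : UAHom A B)
    (hS : ∀ a b, S.rel a b → S'.rel (h.toFun a) (h.toFun b))
    (hT : ∀ a b, T.rel a b → T'.rel (h.toFun a) (h.toFun b))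
    {p q r s : A.carrier} (hm : Mat S T p q r s) :
    Mat S' T' (h.toFun p) (h.toFun q) (h.toFun r) (h.toFun s) := by
  induction hm with
  | vert h => exact .vert (hS _ _ h)
  | horiz h => exact .horiz (hT _ _ h)
  | op f p q r s _ ih => simp only [h.map_op]; exact .op f _ _ _ _ ih

theorem centralizes_mono {A : Alg σ} {S T S' T' δ : Congruence A} (hS : S ≤ S') (hT : T ≤ T')
    (h : Centralizes S' T' δ) : Centralizes S T δ := by
  rw [centralizes_iff] at *
  intro p q r s hm
  exact h p q r s (hm.mono hS hT)

theorem centralizes_commC {A : Alg σ} (S T : Congruence A) : Centralizes S T (commC S T) := by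
  intro m n t a b u v hab huv h δ hδ
  exact hδ m n t a b u v hab huv (h δ hδ)

theorem commC_le {A : Alg σ} {S T δ : Congruence A} (h : Centralizes S T δ) : commC S T ≤ δ :=
  fun _ _ hab => hab δ h

theorem commC_le_left {A : Alg σ} (S T : Congruence A) : commC S T ≤ S := by
  apply commC_le
  rw [centralizes_iff]
  intro p q r s hm h
  exact S.iseqv.trans (S.iseqv.symm hm.left) (S.iseqv.trans h hm.right)

theorem commC_le_right {A : Alg σ} (S T : Congruence A) : commC S T ≤ T := by
  apply commC_le
  rw [centralizes_iff]
  intro p q r s hm h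
  exact hm.bot

def eqCong (A : Alg σ) : Congruence A where
  rel a b := a = b
  iseqv := ⟨fun _ => rfl, Eq.symm, Eq.trans⟩
  compat f a b h := congrArg (A.interp f) (funext h)

theorem bot_eq (A : Alg σ) : (⊥ : Congruence A) = eqCong A := by
  apply le_antisymm bot_le
  intro a b h
  cases h
  exact (⊥ : Congruence A).iseqv.refl _

theorem bot_rel {A : Alg σ} {a b : A.carrier} : (⊥ : Congruence A).rel a b ↔ a = b := by
  rw [bot_eq]; rfl

/-! Quotients -/

noncomputable def quotHom (A : Alg σ) (c : Congruence A) : UAHom A (quotAlg A c) where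
  toFun a := Quotient.mk c.setoid a
  map_op f a := by
    apply Quotient.sound
    apply c.compat
    intro i
    exact c.iseqv.symm (Quotient.mk_out (s := c.setoid) (a i))

theorem quotHom_eq {A : Alg σ} {c : Congruence A} {a b : A.carrier} :
    (quotHom A c).toFun a = (quotHom A c).toFun b ↔ c.rel a b :=
  ⟨fun h => Quotient.exact h, fun h => Quotient.sound (s := c.setoid) h⟩

theorem quotHom_surj (A : Alg σ) (c : Congruence A) : Function.Surjective (quotHom A c).toFun :=
  fun p => ⟨Quotient.out p, Quotient.out_eq p⟩

theorem quot_mem {V : Variety σ} {A : Alg σ} (hA : V.Mem A) (c : Congruence A) :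
    V.Mem (quotAlg A c) := V.closed_hom hA ⟨quotHom A c, quotHom_surj A c⟩

noncomputable def qout {A : Alg σ} {c : Congruence A} (p : (quotAlg A c).carrier) : A.carrier :=
  Quotient.out p

theorem quotHom_qout {A : Alg σ} {c : Congruence A} (p : (quotAlg A c).carrier) :
    (quotHom A c).toFun (qout p) = p := Quotient.out_eq p

theorem qout_quotHom {A : Alg σ} {c : Congruence A} (a : A.carrier) :
    c.rel (qout ((quotHom A c).toFun a)) a := Quotient.mk_out (s := c.setoid) a

noncomputable def quotCong {A : Alg σ} (ψ α : Congruence A) (h : ψ ≤ α) :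
    Congruence (quotAlg A ψ) where
  rel p q := α.rel (qout p) (qout q)
  iseqv := ⟨fun _ => α.iseqv.refl _, fun h => α.iseqv.symm h, fun h h' => α.iseqv.trans h h'⟩
  compat f a b hab :=
    α.iseqv.trans (h _ _ (qout_quotHom _)) (α.iseqv.trans (α.compat f _ _ hab)
      (α.iseqv.symm (h _ _ (qout_quotHom _))))

theorem quotCong_rel {A : Alg σ} {ψ α : Congruence A} (h : ψ ≤ α) {a b : A.carrier} :
    (quotCong ψ α h).rel ((quotHom A ψ).toFun a) ((quotHom A ψ).toFun b) ↔ α.rel a b := by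
  have h1 := h _ _ (qout_quotHom (c := ψ) a)
  have h2 := h _ _ (qout_quotHom (c := ψ) b)
  exact ⟨fun h => α.iseqv.trans (α.iseqv.symm h1) (α.iseqv.trans h h2),
    fun h => α.iseqv.trans h1 (α.iseqv.trans h (α.iseqv.symm h2))⟩

theorem quot_centralizes {A : Alg σ} {ψ α β : Congruence A} (h : ψ ≤ α) (h' : ψ ≤ β) :
    Centralizes (quotCong ψ α h) (quotCong ψ β h') ⊥ ↔ Centralizes α β ψ := by
  constructor
  · rw [centralizes_iff, centralizes_iff]
    intro H p q r s hm hpq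
    have := H _ _ _ _ (hm.map (quotHom A ψ) (fun a b h1 => (quotCong_rel h).2 h1)
      (fun a b h1 => (quotCong_rel h').2 h1))
    rw [bot_rel, bot_rel, quotHom_eq, quotHom_eq] at this
    exact this hpq
  · intro H m n t a b u v hab huv
    have key : ∀ (c : Fin m → (quotAlg A ψ).carrier) (d : Fin n → (quotAlg A ψ).carrier),
        (quotAlg A ψ).evalTrm (Sum.elim c d) t = (quotHom A ψ).toFun
          (A.evalTrm (Sum.elim (fun i => qout (c i)) (fun i => qout (d i))) t) := by
      intro c d
      rw [hom_eval]
      congr 1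
      funext k
      cases k <;> simp [quotHom_qout]
    rw [bot_rel, bot_rel, key, key, key, key, quotHom_eq, quotHom_eq]
    exact H m n t _ _ _ _ hab huv

/-! Polynomials -/

inductive Poly (A : Alg σ) : (A.carrier → A.carrier) → Prop
  | id : Poly A (fun a => a)
  | const (c : A.carrier) : Poly A (fun _ => c)
  | op (f : σ.ops) (h : Fin (σ.arity f) → A.carrier → A.carrier) :
      (∀ i, Poly A (h i)) → Poly A (fun a => A.interp f (fun i => h i a))

theorem Poly.comp {A : Alg σ} {g h : A.carrier → A.carrier} (hg : Poly A g) (hh : Poly A h) :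
    Poly A (fun a => g (h a)) := by
  induction hg with
  | id => exact hh
  | const c => exact .const c
  | op f k _ ih => exact .op f _ ih

theorem Poly.cong {A : Alg σ} {h : A.carrier → A.carrier} (hh : Poly A h) (c : Congruence A)
    {a b : A.carrier} (hab : c.rel a b) : c.rel (h a) (h b) := by
  induction hh with
  | id => exact hab
  | const e => exact c.iseqv.refl e
  | op f k _ ih => exact c.compat f _ _ ih

theorem Poly.mat {A : Alg σ} {S T : Congruence A} {h : A.carrier → A.carrier} (hh : Poly A h)
    {p q r s : A.carrier} (hm : Mat S T p q r s) : Mat S T (h p) (h q) (h r) (h s) := by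
  induction hh with
  | id => exact hm
  | const e => exact Mat.const e
  | op f k _ ih => exact Mat.op f _ _ _ _ ih

theorem compat_of_poly {A : Alg σ} (rel : A.carrier → A.carrier → Prop) (he : Equivalence rel)
    (hp : ∀ h, Poly A h → ∀ a b, rel a b → rel (h a) (h b)) :
    ∀ (f : σ.ops) (a b : Fin (σ.arity f) → A.carrier),
    (∀ i, rel (a i) (b i)) → rel (A.interp f a) (A.interp f b) := by
  intro f a b hab
  classical
  have key : ∀ s : Finset (Fin (σ.arity f)), rel (A.interp f a) (A.interp f (s.piecewise b a)) := by
    intro s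
    induction s using Finset.induction_on with
    | empty => simpa using he.refl _
    | insert i s hi ih =>
      refine he.trans ih ?_
      have h1 := hp (fun c => A.interp f (fun j => (Function.update (s.piecewise b a) i c) j))
        (.op f (fun j c => (Function.update (s.piecewise b a) i c) j) (by
          intro j
          by_cases hj : j = i
          · subst hj
            simpa using Poly.id
          · simpa [hj] using Poly.const _)) (a i) (b i) (hab i)
      have h2 : Function.update (s.piecewise b a) i (a i) = s.piecewise b a := by
        apply Function.update_eq_self_iff.2
        simp [hi]
      have h3 : Function.update (s.piecewise b a) i (b i) = (insert i s).piecewise b a := by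
        rw [Finset.piecewise_insert]
      simpa [h2, h3] using h1
  have := key Finset.univ
  simpa using this

/-- largest congruence below `base` whose restriction to `X` is inside `Q` -/
def bigCong {A : Alg σ} (base : Congruence A) (X : A.carrier → Prop)
    (Q : A.carrier → A.carrier → Prop)
    (hX : ∀ a b, base.rel a b → X a → X b) (hr : ∀ a, X a → Q a a)
    (hs : ∀ a b, X a → X b → Q a b → Q b a)
    (ht : ∀ a b c, X a → X b → X c → Q a b → Q b c → Q a c) : Congruence A where
  rel a b := base.rel a b ∧ ∀ h, Poly A h → X (h a) → Q (h a) (h b)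
  iseqv := ⟨fun a => ⟨base.iseqv.refl a, fun h _ hx => hr _ hx⟩,
    fun {a b} hab => ⟨base.iseqv.symm hab.1, fun h hh hx =>
      have hx' := hX _ _ (hh.cong base (base.iseqv.symm hab.1)) hx
      hs _ _ hx' hx (hab.2 h hh hx')⟩,
    fun {a b c} hab hbc => ⟨base.iseqv.trans hab.1 hbc.1, fun h hh hx =>
      have hx' := hX _ _ (hh.cong base hab.1) hx
      have hx'' := hX _ _ (hh.cong base hbc.1) hx'
      ht _ _ _ hx hx' hx'' (hab.2 h hh hx) (hbc.2 h hh hx')⟩⟩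
  compat := by
    apply compat_of_poly (fun a b => base.rel a b ∧ ∀ h, Poly A h → X (h a) → Q (h a) (h b))
    · exact ⟨fun a => ⟨base.iseqv.refl a, fun h _ hx => hr _ hx⟩,
        fun {a b} hab => ⟨base.iseqv.symm hab.1, fun h hh hx =>
          have hx' := hX _ _ (hh.cong base (base.iseqv.symm hab.1)) hx
          hs _ _ hx' hx (hab.2 h hh hx')⟩,
        fun {a b c} hab hbc => ⟨base.iseqv.trans hab.1 hbc.1, fun h hh hx =>
          have hx' := hX _ _ (hh.cong base hab.1) hx
          have hx'' := hX _ _ (hh.cong base hbc.1) hx'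
          ht _ _ _ hx hx' hx'' (hab.2 h hh hx) (hbc.2 h hh hx')⟩⟩
    · intro h hh a b hab
      exact ⟨hh.cong base hab.1, fun g hg hx => hab.2 _ (hg.comp hh) hx⟩

theorem bigCong_centralizes {A : Alg σ} (base T : Congruence A) (X : A.carrier → Prop)
    (Q : A.carrier → A.carrier → Prop)
    (hX : ∀ a b, base.rel a b → X a → X b) (hr : ∀ a, X a → Q a a)
    (hs : ∀ a b, X a → X b → Q a b → Q b a)
    (ht : ∀ a b c, X a → X b → X c → Q a b → Q b c → Q a c)
    (H : ∀ p q r s, Mat base T p q r s → X p → X q → X r → X s → Q p q → Q r s) :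
    Centralizes base T (bigCong base X Q hX hr hs ht) := by
  rw [centralizes_iff]
  rintro p q r s hm ⟨h1, h2⟩
  have hrs : base.rel r s :=
    base.iseqv.trans (base.iseqv.symm hm.left) (base.iseqv.trans h1 hm.right)
  refine ⟨hrs, fun h hh hx => ?_⟩
  have hm' := hh.mat hm
  have hxp := hX _ _ (base.iseqv.symm hm'.left) hx
  exact H _ _ _ _ hm' hxp (hX _ _ (hh.cong base h1) hxp) hx (hX _ _ (hh.cong base hrs) hx)
    (h2 h hh hxp)

/-! Free algebras -/

def sat (V : Variety σ) {X : Type} (s t : Trm σ X) : Prop :=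
  ∀ A : Alg σ, V.Mem A → ∀ asg : X → A.carrier, A.evalTrm asg s = A.evalTrm asg t

abbrev termAlg (σ : Sig) (X : Type) : Alg σ where
  carrier := Trm σ X
  interp f a := Trm.op f a

def satCong (V : Variety σ) (X : Type) : Congruence (termAlg σ X) where
  rel s t := sat V s t
  iseqv := ⟨fun _ _ _ _ => rfl, fun h A hA asg => (h A hA asg).symm,
    fun h h' A hA asg => (h A hA asg).trans (h' A hA asg)⟩
  compat f a b h A hA asg := by
    show A.interp f _ = A.interp f _
    congr 1
    funext i
    exact h i A hA asg

noncomputable def FA (V : Variety σ) (X : Type) : Alg σ := quotAlg (termAlg σ X) (satCong V X)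

noncomputable def gen (V : Variety σ) {X : Type} (v : X) : (FA V X).carrier :=
  (quotHom (termAlg σ X) (satCong V X)).toFun (Trm.var v)

def evalHom (A : Alg σ) {X : Type} (asg : X → A.carrier) : UAHom (termAlg σ X) A where
  toFun t := A.evalTrm asg t
  map_op f a := rfl

theorem termAlg_eval {X Y : Type} (s : X → Trm σ Y) (t : Trm σ X) :
    (termAlg σ Y).evalTrm s t = t.bind s := by
  induction t with
  | var v => rfl
  | op f ts ih =>
    show Trm.op f _ = Trm.op f _
    congr 1
    funext i
    exact ih i

theorem bind_var {X : Type} (t : Trm σ X) : t.bind (fun v => Trm.var v) = t := by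
  induction t with
  | var v => rfl
  | op f ts ih => simp only [Trm.bind, ih]

theorem eval_gen (V : Variety σ) {X : Type} (t : Trm σ X) :
    (FA V X).evalTrm (fun v => gen V v) t = (quotHom (termAlg σ X) (satCong V X)).toFun t := by
  have := hom_eval (quotHom (termAlg σ X) (satCong V X)) (fun v => Trm.var v) t
  rw [termAlg_eval, bind_var] at this
  exact this.symm

theorem FA_exists (V : Variety σ) {X : Type} (p : (FA V X).carrier) :
    ∃ t : Trm σ X, p = (FA V X).evalTrm (fun v => gen V v) t := by
  obtain ⟨t, rfl⟩ := quotHom_surj _ _ p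
  exact ⟨t, (eval_gen V t).symm⟩

theorem FA_eq (V : Variety σ) {X : Type} {s t : Trm σ X} :
    (FA V X).evalTrm (fun v => gen V v) s = (FA V X).evalTrm (fun v => gen V v) t ↔ sat V s t := by
  rw [eval_gen, eval_gen]
  exact quotHom_eq (c := satCong V X)

noncomputable def ev {V : Variety σ} {A : Alg σ} (hA : V.Mem A) {X : Type} (asg : X → A.carrier) :
    UAHom (FA V X) A where
  toFun := Quotient.lift (fun t => A.evalTrm asg t) (fun s t h => h A hA asg)
  map_op f a := by
    show A.evalTrm asg (Trm.op f fun i => (a i).out) = _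
    show A.interp f _ = _
    congr 1
    funext i
    conv_rhs => rw [← Quotient.out_eq (a i)]
    rfl

theorem ev_gen {V : Variety σ} {A : Alg σ} (hA : V.Mem A) {X : Type} (asg : X → A.carrier)
    (v : X) : (ev hA asg).toFun (gen V v) = asg v := rfl

theorem ev_eval {V : Variety σ} {A : Alg σ} (hA : V.Mem A) {X Y : Type} (asg : X → A.carrier)
    (g : Y → (FA V X).carrier) (t : Trm σ Y) :
    (ev hA asg).toFun ((FA V X).evalTrm g t) = A.evalTrm (fun v => (ev hA asg).toFun (g v)) t :=
  hom_eval _ _ _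

def homKer {A B : Alg σ} (h : UAHom A B) : Congruence A where
  rel a b := h.toFun a = h.toFun b
  iseqv := ⟨fun _ => rfl, Eq.symm, Eq.trans⟩
  compat f a b hab := by
    rw [h.map_op, h.map_op]
    congr 1
    funext i
    exact hab i

noncomputable def kerInj {A B : Alg σ} (h : UAHom A B) : UAHom (quotAlg A (homKer h)) B where
  toFun p := h.toFun (qout p)
  map_op f a := by
    have : h.toFun _ = h.toFun _ := qout_quotHom (c := homKer h) (A.interp f fun i => qout (a i))
    rw [h.map_op] at this
    exact this

theorem kerInj_inj {A B : Alg σ} (h : UAHom A B) : Function.Injective (kerInj h).toFun := by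
  intro p q hpq
  rw [← quotHom_qout p, ← quotHom_qout q, quotHom_eq]
  exact hpq

theorem FA_mem (V : Variety σ) (X : Type) : V.Mem (FA V X) := by
  let I := {c : Congruence (termAlg σ X) // V.Mem (quotAlg _ c)}
  have hP : V.Mem (prodAlg (fun c : I => quotAlg (termAlg σ X) c.1)) :=
    V.closed_prod _ (fun c => c.2)
  refine V.closed_sub hP ⟨ev hP (fun v c => (quotHom (termAlg σ X) c.1).toFun (Trm.var v)), ?_⟩
  intro p q hpq
  obtain ⟨s, rfl⟩ := FA_exists V p
  obtain ⟨t, rfl⟩ := FA_exists V q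
  rw [FA_eq]
  intro A hA asg
  have hI : V.Mem (quotAlg _ (homKer (evalHom A asg))) :=
    V.closed_sub hA ⟨kerInj _, kerInj_inj _⟩
  have h1 := congrFun hpq ⟨_, hI⟩
  have proj : ∀ r : Trm σ X, (ev hP (fun v c => (quotHom (termAlg σ X) c.1).toFun
      (Trm.var v))).toFun ((FA V X).evalTrm (fun v => gen V v) r) ⟨_, hI⟩ =
      (quotHom (termAlg σ X) (homKer (evalHom A asg))).toFun r := by
    intro r
    have h2 := hom_eval (A := prodAlg (fun c : I => quotAlg (termAlg σ X) c.1))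
      (B := quotAlg (termAlg σ X) (homKer (evalHom A asg)))
      ⟨fun a => a ⟨_, hI⟩, fun f a => rfl⟩
      (fun v c => (quotHom (termAlg σ X) c.1).toFun (Trm.var v)) r
    refine (congrFun (ev_eval hP _ (fun v => gen V v) r) ⟨_, hI⟩).trans (h2.trans ?_)
    have h3 := hom_eval (quotHom (termAlg σ X) (homKer (evalHom A asg))) (fun v => Trm.var v) r
    rw [termAlg_eval, bind_var] at h3
    exact h3.symm
  exact (quotHom_eq (c := homKer (evalHom A asg))).1 ((proj s).symm.trans (h1.trans (proj t)))

/-- Polynomials of free algebras. -/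
theorem Poly.form {V : Variety σ} {X : Type} {h : (FA V X).carrier → (FA V X).carrier}
    (hh : Poly (FA V X) h) : ∃ g : Trm σ (Option X), ∀ a, h a =
      (FA V X).evalTrm (fun o => o.elim a (fun v => gen V v)) g := by
  induction hh with
  | id => exact ⟨.var none, fun a => rfl⟩
  | const c =>
    obtain ⟨t, rfl⟩ := FA_exists V c
    refine ⟨t.bind (fun v => .var (some v)), fun a => ?_⟩
    rw [eval_bind]
    rfl
  | op f k _ ih =>
    choose g hg using ih
    refine ⟨.op f g, fun a => ?_⟩
    show (FA V X).interp f _ = (FA V X).interp f _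
    congr 1
    funext i
    exact hg i a

/-- the kernel of `F(X) → F(1)` -/
def thetaC (V : Variety σ) (X : Type) : Congruence (FA V X) where
  rel p q := ∀ (A : Alg σ) (hA : V.Mem A) (c : A.carrier),
    (ev hA (fun _ => c)).toFun p = (ev hA (fun _ => c)).toFun q
  iseqv := ⟨fun _ _ _ _ => rfl, fun h A hA c => (h A hA c).symm,
    fun h h' A hA c => (h A hA c).trans (h' A hA c)⟩
  compat f a b h A hA c := by
    rw [UAHom.map_op, UAHom.map_op]
    congr 1
    funext i
    exact h i A hA c

/-- idempotent elements -/
def IdemE (V : Variety σ) {X : Type} (p : (FA V X).carrier) : Prop :=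
  ∀ (A : Alg σ) (hA : V.Mem A) (c : A.carrier), (ev hA (fun _ => c)).toFun p = c

theorem IdemE.gen {V : Variety σ} {X : Type} (v : X) : IdemE V (gen V v) := fun _ _ _ => rfl

theorem IdemE.theta {V : Variety σ} {X : Type} {p q : (FA V X).carrier} (hp : IdemE V p)
    (hq : IdemE V q) : (thetaC V X).rel p q := fun A hA c => (hp A hA c).trans (hq A hA c).symm

theorem IdemE.sat {V : Variety σ} {X : Type} {p q : (FA V X).carrier}
    (h : (thetaC V X).rel p q) (hp : IdemE V p) : IdemE V q :=
  fun A hA c => (h A hA c).symm.trans (hp A hA c)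

theorem theta_ev {V : Variety σ} {X : Type} {p q : (FA V X).carrier} (h : (thetaC V X).rel p q)
    {A : Alg σ} (hA : V.Mem A) (ε : Congruence A) (asg : X → A.carrier) (c : A.carrier)
    (hc : ∀ v, ε.rel (asg v) c) : ε.rel ((ev hA asg).toFun p) ((ev hA asg).toFun q) := by
  have key : ∀ r : (FA V X).carrier,
      ε.rel ((ev hA asg).toFun r) ((ev hA (fun _ => c)).toFun r) := by
    intro r
    obtain ⟨t, rfl⟩ := FA_exists V r
    rw [ev_eval, ev_eval]
    exact cong_eval ε hc t
  have := h A hA c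
  exact ε.iseqv.trans (key p) (this ▸ ε.iseqv.symm (key q))

/-! Difference terms give commutativity -/

theorem diff_rel {V : Variety σ} {d : Trm σ (Fin 3)} (hd : IsDifferenceTrm V d) {A : Alg σ}
    (hA : V.Mem A) {γ δ : Congruence A} (hle : δ ≤ γ) (hc : Centralizes γ γ δ) {a b : A.carrier}
    (hab : γ.rel a b) : δ.rel (A.evalTrm ![a, b, b] d) a := by
  have h1 : IsAbelianCong (quotCong δ γ hle) := by
    apply le_bot_iff.1
    apply commC_le
    exact (quot_centralizes hle hle).2 hc
  have h2 := hd.2 _ (quot_mem hA δ) _ h1 ((quotHom A δ).toFun a) ((quotHom A δ).toFun b)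
    ((quotCong_rel hle).2 hab)
  rw [← quotHom_eq, hom_eval, ← h2]
  congr 1
  funext i
  fin_cases i <;> simp

theorem diff_comm_le {V : Variety σ} {d : Trm σ (Fin 3)} (hd : IsDifferenceTrm V d) {A : Alg σ}
    (hA : V.Mem A) (α β : Congruence A) : commC β α ≤ commC α β := by
  apply commC_le
  set δ := commC α β with hδ
  have hC : Centralizes α β δ := centralizes_commC α β
  have hle : δ ≤ α ⊓ β := le_inf (commC_le_left _ _) (commC_le_right _ _)
  have hγ : Centralizes (α ⊓ β) (α ⊓ β) δ := centralizes_mono inf_le_left inf_le_right hC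
  rw [centralizes_iff] at hC ⊢
  intro p q r s hm hpq
  have hm' := hm.flip
  -- `r β s`, since `r β p δ q β s`
  have hrs : (α ⊓ β).rel r s := by
    have h1 : α ⊓ β = sInf {α, β} := by simp
    rw [h1]
    rintro c (rfl | rfl)
    · exact hm.bot
    · exact c.iseqv.trans (c.iseqv.symm hm.left)
        (c.iseqv.trans ((hle.trans inf_le_right) _ _ hpq) hm.right)
  have hd1 := diff_rel hd hA hle hγ hrs
  have e1 := hC (A.evalTrm ![p, p, r] d) (A.evalTrm ![r, r, r] d) (A.evalTrm ![p, q, s] d)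
    (A.evalTrm ![r, s, s] d) (by
      apply Mat.eval
      intro i
      fin_cases i
      · exact Mat.horiz hm.left
      · exact hm'
      · exact Mat.vert hm.bot) (by
      rw [hd.1 A hA, hd.1 A hA]; exact δ.iseqv.refl _)
  -- d(p,q,s) δ d(p,p,s) = s
  have e2 : δ.rel (A.evalTrm ![p, q, s] d) (A.evalTrm ![p, p, s] d) := by
    apply cong_eval
    intro i
    fin_cases i
    · exact δ.iseqv.refl _
    · exact δ.iseqv.symm hpq
    · exact δ.iseqv.refl _
  rw [hd.1 A hA] at e2
  exact δ.iseqv.trans (δ.iseqv.symm hd1)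
    (δ.iseqv.trans (δ.iseqv.symm e1) e2)

/-- the difference element is congruent to `x` -/
theorem ev_theta_central {V : Variety σ} {X : Type} {A : Alg σ} (hA : V.Mem A) (ε : Congruence A)
    (hε : IsAbelianCong ε) (asg : X → A.carrier) (c : A.carrier) (hc : ∀ v, ε.rel (asg v) c) :
    commC (thetaC V X) (thetaC V X) ≤ homKer (ev hA asg) := by
  apply commC_le
  have h1 : Centralizes ε ε ⊥ := by
    have := centralizes_commC ε ε
    rwa [hε] at this
  rw [centralizes_iff] at h1 ⊢
  intro p q r s hm hpq
  have := h1 _ _ _ _ (hm.map (ev hA asg) (fun a b h => theta_ev h hA ε asg c hc)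
    (fun a b h => theta_ev h hA ε asg c hc))
  rw [bot_rel, bot_rel] at this
  exact this hpq

/-! From Taylor + commutativity to a difference term -/

theorem Mat.eval3 {A : Alg σ} {S T : Congruence A} {p₁ q₁ r₁ s₁ p₂ q₂ r₂ s₂ p₃ q₃ r₃ s₃ : A.carrier}
    (t : Trm σ (Fin 3))
    (h₁ : Mat S T p₁ q₁ r₁ s₁) (h₂ : Mat S T p₂ q₂ r₂ s₂) (h₃ : Mat S T p₃ q₃ r₃ s₃) :
    Mat S T (A.evalTrm ![p₁, p₂, p₃] t) (A.evalTrm ![q₁, q₂, q₃] t) (A.evalTrm ![r₁, r₂, r₃] t)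
      (A.evalTrm ![s₁, s₂, s₃] t) := by
  apply Mat.eval
  intro i
  fin_cases i
  · exact h₁
  · exact h₂
  · exact h₃

theorem bind3 (A : Alg σ) {Y : Type} (t : Trm σ (Fin 3)) (s₁ s₂ s₃ : Trm σ Y)
    (asg : Y → A.carrier) : A.evalTrm asg (t.bind ![s₁, s₂, s₃]) =
      A.evalTrm ![A.evalTrm asg s₁, A.evalTrm asg s₂, A.evalTrm asg s₃] t := by
  rw [eval_bind]
  congr 1
  funext i
  fin_cases i <;> rfl

def Exact (V : Variety σ) (t : Trm σ (Fin 3)) : Prop :=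
  ∀ A : Alg σ, V.Mem A → ∀ a b : A.carrier, A.evalTrm ![a, a, b] t = b

theorem exact_var (V : Variety σ) : Exact V (Trm.var 2) := fun _ _ _ _ => rfl

/-- the two-generated free algebra -/
noncomputable abbrev F2 (V : Variety σ) : Alg σ := FA V Bool

noncomputable abbrev gx (V : Variety σ) : (F2 V).carrier := gen V true
noncomputable abbrev gy (V : Variety σ) : (F2 V).carrier := gen V false

noncomputable abbrev th (V : Variety σ) : Congruence (F2 V) := thetaC V Bool
noncomputable abbrev del (V : Variety σ) : Congruence (F2 V) := commC (th V) (th V)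

theorem th_gen (V : Variety σ) (u v : Bool) : (th V).rel (gen V u) (gen V v) :=
  fun _ _ _ => rfl

theorem del_mat {V : Variety σ} {p q r s : (F2 V).carrier} (hm : Mat (th V) (th V) p q r s)
    (h : (del V).rel p q) : (del V).rel r s :=
  centralizes_iff.1 (centralizes_commC (th V) (th V)) _ _ _ _ hm h

def Kp (V : Variety σ) (a b : (F2 V).carrier) : Prop :=
  ∃ t : Trm σ (Fin 3), Exact V t ∧ (del V).rel ((F2 V).evalTrm ![gx V, gy V, a] t) b

theorem Kp_refl {V : Variety σ} (a : (F2 V).carrier) : Kp V a a :=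
  ⟨_, exact_var V, (del V).iseqv.refl _⟩

theorem Kp_trans {V : Variety σ} {a b c : (F2 V).carrier} (hab : Kp V a b) (hbc : Kp V b c) :
    Kp V a c := by
  obtain ⟨t, ht, h1⟩ := hab
  obtain ⟨u, hu, h2⟩ := hbc
  refine ⟨u.bind ![Trm.var 0, Trm.var 1, t], ?_, ?_⟩
  · intro A hA a b
    rw [bind3]
    exact (hu A hA _ _).trans (ht A hA a b)
  · rw [bind3]
    refine (del V).iseqv.trans ?_ h2
    apply cong_eval
    intro i
    fin_cases i
    · exact (del V).iseqv.refl _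
    · exact (del V).iseqv.refl _
    · exact h1

theorem Kp_symm {V : Variety σ} {a b : (F2 V).carrier} (hab : Kp V a b) : Kp V b a := by
  obtain ⟨t, ht, h1⟩ := hab
  refine ⟨t.bind ![Trm.var 1, Trm.var 0, Trm.var 2], ?_, ?_⟩
  · intro A hA a b
    rw [bind3]
    exact ht A hA _ _
  · rw [bind3]
    show (del V).rel ((F2 V).evalTrm ![gy V, gx V, b] t) a
    have hF := FA_mem V Bool
    have key := del_mat (Mat.eval3 t (Mat.vert (th_gen V true false))
      (Mat.horiz (th_gen V true false)) (Mat.eval3 t (Mat.const (gx V))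
        (Mat.horiz (th_gen V false true)) (Mat.const a)))
      (by rw [ht _ hF, ht _ hF]; exact (del V).iseqv.refl _)
    rw [ht _ hF, ht _ hF] at key
    refine (del V).iseqv.trans ?_ key
    apply cong_eval
    intro i
    fin_cases i
    · exact (del V).iseqv.refl _
    · exact (del V).iseqv.refl _
    · exact (del V).iseqv.symm h1

noncomputable def kap (V : Variety σ) : Congruence (F2 V) :=
  bigCong (th V) (IdemE V) (Kp V) (fun _ _ h hp => IdemE.sat h hp) (fun a _ => Kp_refl a)
    (fun _ _ _ _ => Kp_symm) (fun _ _ _ _ _ _ => Kp_trans)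

theorem kap_central (V : Variety σ) : Centralizes (th V) (th V) (kap V) := by
  apply bigCong_centralizes
  rintro p q r s hm - - - - ⟨t, ht, h⟩
  refine ⟨t, ht, ?_⟩
  have hF := FA_mem V Bool
  have := del_mat (Mat.eval3 t (Mat.const (gx V)) (Mat.horiz (th_gen V false true)) hm)
  rw [ht _ hF, ht _ hF] at this
  exact this h

theorem kap_mat {V : Variety σ} {p q r s : (F2 V).carrier} (hm : Mat (th V) (th V) p q r s)
    (h : (kap V).rel p q) : (kap V).rel r s :=
  centralizes_iff.1 (kap_central V) _ _ _ _ hm h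

theorem kap_exact {V : Variety σ} {t : Trm σ (Fin 3)} (ht : Exact V t) {a : (F2 V).carrier}
    (ha : IdemE V a) : (kap V).rel a ((F2 V).evalTrm ![gx V, gy V, a] t) := by
  have hF := FA_mem V Bool
  refine ⟨?_, ?_⟩
  · intro A hA c
    rw [ev_eval, ha A hA c]
    have : (fun v => (ev hA fun _ => c).toFun (![gx V, gy V, a] v)) = ![c, c, c] := by
      funext i
      fin_cases i
      · rfl
      · rfl
      · exact ha A hA c
    rw [this, ht A hA]
  · intro h hh hx
    obtain ⟨g, hg⟩ := hh.form
    -- `g` is idempotent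
    have gid : ∀ (A : Alg σ) (hA : V.Mem A) (c : A.carrier), A.evalTrm (fun _ => c) g = c := by
      intro A hA c
      have := hx A hA c
      rw [hg, ev_eval] at this
      refine Eq.trans ?_ this
      congr 1
      funext o
      cases o with
      | none => exact (ha A hA c).symm
      | some v => rfl
    refine ⟨g.bind (fun o => o.elim t (fun _ => Trm.var 2)), ?_, ?_⟩
    · intro A hA a b
      rw [eval_bind]
      refine Eq.trans ?_ (gid A hA b)
      congr 1
      funext o
      cases o with
      | none => exact ht A hA a b
      | some v => rfl
    · set c := h a with hc
      have hm : Mat (th V) (th V)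
          ((F2 V).evalTrm (fun o : Option Bool => o.elim
            ((F2 V).evalTrm ![gx V, gx V, c] t) (fun _ => c)) g)
          ((F2 V).evalTrm (fun o : Option Bool => o.elim
            ((F2 V).evalTrm ![gx V, gx V, a] t) (fun v => gen V v)) g)
          ((F2 V).evalTrm (fun o : Option Bool => o.elim
            ((F2 V).evalTrm ![gx V, gy V, c] t) (fun _ => c)) g)
          ((F2 V).evalTrm (fun o : Option Bool => o.elim
            ((F2 V).evalTrm ![gx V, gy V, a] t) (fun v => gen V v)) g) := by
        apply Mat.eval
        intro o
        cases o with
        | none =>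
          exact Mat.eval3 t (Mat.const (gx V)) (Mat.vert (th_gen V true false))
            (Mat.horiz (hx.theta ha))
        | some v => exact Mat.horiz (hx.theta (IdemE.gen v))
      have key := del_mat hm (by
        rw [ht _ hF, ht _ hF, ← hg]
        have : (fun o : Option Bool => o.elim c (fun _ => c)) = fun _ => c := by
          funext o; cases o <;> rfl
        rw [this, gid _ hF]
        exact (del V).iseqv.refl _)
      rw [← hg] at key
      rw [eval_bind]
      have : (fun o : Option Bool => (F2 V).evalTrm ![gx V, gy V, c]
          (o.elim t (fun _ => Trm.var 2))) =
          (fun o : Option Bool => o.elim ((F2 V).evalTrm ![gx V, gy V, c] t) (fun _ => c)) := by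
        funext o; cases o <;> rfl
      rw [this]
      exact key

theorem diff_of_kap {V : Variety σ} (h : (kap V).rel (gy V) (gx V)) :
    ∃ d : Trm σ (Fin 3), IsDifferenceTrm V d := by
  obtain ⟨t, ht, h1⟩ := h.2 _ Poly.id (IdemE.gen _)
  refine ⟨t, ht, ?_⟩
  intro A hA α hα a b hab
  have h2 : (ev hA (fun v : Bool => cond v a b)).toFun _ = (ev hA _).toFun _ :=
    ev_theta_central hA α hα (fun v : Bool => cond v a b) a
    (by rintro (_ | _); exacts [α.iseqv.symm hab, α.iseqv.refl _]) _ _ h1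
  rw [ev_eval] at h2
  refine Eq.trans ?_ h2
  congr 1
  funext i
  fin_cases i <;> rfl

/-- the three-generated free algebra -/
noncomputable abbrev F3 (V : Variety σ) : Alg σ := FA V (Fin 3)

/-- the kernel of `x, y, z ↦ x, x, z` -/
def alp (V : Variety σ) : Congruence (F3 V) where
  rel p q := ∀ (A : Alg σ) (hA : V.Mem A) (a b : A.carrier),
    (ev hA ![a, a, b]).toFun p = (ev hA ![a, a, b]).toFun q
  iseqv := ⟨fun _ _ _ _ _ => rfl, fun h A hA a b => (h A hA a b).symm,
    fun h h' A hA a b => (h A hA a b).trans (h' A hA a b)⟩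
  compat f a b h A hA c d := by
    rw [UAHom.map_op, UAHom.map_op]
    congr 1
    funext i
    exact h i A hA c d

theorem alp_le (V : Variety σ) : alp V ≤ thetaC V (Fin 3) := by
  intro p q h A hA c
  have : (fun _ => c : Fin 3 → A.carrier) = ![c, c, c] := by
    funext i; fin_cases i <;> rfl
  rw [this]
  exact h A hA c c

/-- the `alp`-class of `x` -/
def NN (V : Variety σ) (p : (F3 V).carrier) : Prop :=
  ∀ (A : Alg σ) (hA : V.Mem A) (a b : A.carrier), (ev hA ![a, a, b]).toFun p = a

/-- the homomorphism `x, y, z ↦ x, y, y` -/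
noncomputable def pi2 (V : Variety σ) : UAHom (F3 V) (F2 V) :=
  ev (FA_mem V Bool) ![gx V, gy V, gy V]

theorem pi2_theta {V : Variety σ} {p q : (F3 V).carrier} (h : (thetaC V (Fin 3)).rel p q) :
    (th V).rel ((pi2 V).toFun p) ((pi2 V).toFun q) :=
  theta_ev h (FA_mem V Bool) (th V) _ (gx V) (by
    intro v
    fin_cases v
    · exact th_gen V _ _
    · exact th_gen V _ _
    · exact th_gen V _ _)

noncomputable def psi (V : Variety σ) : Congruence (F3 V) :=
  bigCong (alp V) (NN V) (fun p q => (kap V).rel ((pi2 V).toFun p) ((pi2 V).toFun q))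
    (fun _ _ h hp A hA a b => (h A hA a b).symm.trans (hp A hA a b))
    (fun _ _ => (kap V).iseqv.refl _) (fun _ _ _ _ h => (kap V).iseqv.symm h)
    (fun _ _ _ _ _ _ h h' => (kap V).iseqv.trans h h')

theorem psi_le (V : Variety σ) : psi V ≤ alp V := fun _ _ h => h.1

theorem psi_central (V : Variety σ) : Centralizes (alp V) (thetaC V (Fin 3)) (psi V) := by
  apply bigCong_centralizes
  intro p q r s hm _ _ _ _ h
  exact kap_mat (hm.map (pi2 V) (fun a b h => pi2_theta (alp_le V _ _ h))
    (fun a b h => pi2_theta h)) h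

theorem psi_central' {V : Variety σ} (hV : ∀ A : Alg σ, V.Mem A → ∀ x y : Congruence A, x ≤ y →
        commC x y = commC y x) : Centralizes (thetaC V (Fin 3)) (alp V) (psi V) := by
  have hle := psi_le V
  have hle' := hle.trans (alp_le V)
  rw [← quot_centralizes hle' hle]
  have h1 : commC (quotCong (psi V) (alp V) hle) (quotCong (psi V) _ hle') = ⊥ :=
    le_bot_iff.1 (commC_le ((quot_centralizes hle hle').2 (psi_central V)))
  rw [hV _ (quot_mem (FA_mem V (Fin 3)) _) _ _ (fun a b h => alp_le V _ _ h)] at h1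
  rw [← h1]
  exact centralizes_commC _ _

/-- assignments from a Boolean vector with place `i` replaced -/
def upd {n : ℕ} {C : Type} (w : Fin n → Bool) (i : Fin n) (a b c : C) : Fin n → C :=
  fun j => if j = i then c else cond (w j) a b

theorem taylor_dep {V : Variety σ}
    (hV : ∀ A : Alg σ, V.Mem A → ∀ x y : Congruence A, x ≤ y → commC x y = commC y x)
    {n : ℕ} {T : Trm σ (Fin n)}
    (hid : ∀ A : Alg σ, V.Mem A → ∀ c : A.carrier, A.evalTrm (fun _ => c) T = c)
    (i : Fin n) (w w' : Fin n → Bool) (hw : w i = false) (hw' : w' i = true)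
    (hT : ∀ A : Alg σ, V.Mem A → ∀ x y : A.carrier,
      A.evalTrm (fun j => cond (w j) x y) T = A.evalTrm (fun j => cond (w' j) x y) T) :
    (kap V).rel (gx V) ((F2 V).evalTrm (fun j => if j = i then gy V else gx V) T) := by
  have hF := FA_mem V Bool
  let x : (F3 V).carrier := gen V 0
  let y : (F3 V).carrier := gen V 1
  let z : (F3 V).carrier := gen V 2
  have updw' : ∀ {C : Type} (a b : C), upd w' i a b a = fun j => cond (w' j) a b := by
    intro C a b
    funext j
    unfold upd
    split_ifs with h
    · rw [h, hw']; rfl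
    · rfl
  have updw : ∀ {C : Type} (a b : C), upd w i a b b = fun j => cond (w j) a b := by
    intro C a b
    funext j
    unfold upd
    split_ifs with h
    · rw [h, hw]; rfl
    · rfl
  have hpsi : (psi V).rel ((F3 V).evalTrm (upd w' i x z x) T)
      ((F3 V).evalTrm (upd w' i x z y) T) := by
    refine ⟨?_, ?_⟩
    · apply cong_eval
      intro j
      unfold upd
      split_ifs with h
      · intro A hA a b; rfl
      · exact (alp V).iseqv.refl _
    · intro h hh hN
      obtain ⟨g, hg⟩ := hh.form
      -- identity from membership in N
      have H : ∀ (A : Alg σ) (hA : V.Mem A) (a b : A.carrier),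
          A.evalTrm (fun o : Option (Fin 3) => o.elim
            (A.evalTrm (fun j => cond (w j) a b) T) ![a, a, b]) g = a := by
        intro A hA a b
        rw [hT A hA]
        refine Eq.trans ?_ (hN A hA a b)
        rw [hg, ev_eval]
        congr 1
        funext o
        cases o with
        | none =>
          simp only [Option.elim]
          rw [ev_eval, updw']
          congr 1
          funext j
          show _ = (ev hA ![a, a, b]).toFun (cond (w' j) x z)
          cases w' j <;> rfl
        | some v => rfl
      let t : Trm σ (Fin 3) := g.bind (fun o => o.elim
        (T.bind (fun j => Trm.var (upd w i 2 0 1 j)))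
        (fun v => Trm.var ((![2, 2, 0] : Fin 3 → Fin 3) v)))
      have evt : ∀ (A : Alg σ) (p q a : A.carrier), A.evalTrm ![p, q, a] t =
          A.evalTrm (fun o : Option (Fin 3) => o.elim
            (A.evalTrm (upd w i a p q) T) ![a, a, p]) g := by
        intro A p q a
        simp only [t]
        rw [eval_bind]
        congr 1
        funext o
        cases o with
        | none =>
          simp only [Option.elim]
          rw [eval_bind]
          congr 1
          funext j
          simp only [eval_var, upd]
          split_ifs
          · rfl
          · cases w j <;> rfl
        | some v => fin_cases v <;> rfl
      have ht : Exact V t := by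
        intro A hA a b
        rw [evt, updw]
        exact H A hA b a
      have h1 := kap_exact ht (IdemE.gen (V := V) true)
      have h2 := ht _ hF (gx V) (gx V)
      rw [evt] at h1 h2
      -- now move the other parameters
      have hm : Mat (th V) (th V)
          ((F2 V).evalTrm (fun o : Option (Fin 3) => o.elim
            ((F2 V).evalTrm (upd w i (gx V) (gx V) (gx V)) T) ![gx V, gx V, gx V]) g)
          ((F2 V).evalTrm (fun o : Option (Fin 3) => o.elim
            ((F2 V).evalTrm (upd w i (gx V) (gx V) (gy V)) T) ![gx V, gx V, gx V]) g)
          ((F2 V).evalTrm (fun o : Option (Fin 3) => o.elim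
            ((F2 V).evalTrm (upd w' i (gx V) (gy V) (gx V)) T) ![gx V, gy V, gy V]) g)
          ((F2 V).evalTrm (fun o : Option (Fin 3) => o.elim
            ((F2 V).evalTrm (upd w' i (gx V) (gy V) (gy V)) T) ![gx V, gy V, gy V]) g) := by
        apply Mat.eval
        intro o
        cases o with
        | none =>
          apply Mat.eval
          intro j
          unfold upd
          split_ifs
          · exact Mat.horiz (th_gen V _ _)
          · cases w j <;> cases w' j <;> exact Mat.vert (th_gen V _ _)
        | some v => fin_cases v <;> exact Mat.vert (th_gen V _ _)
      have h3 := kap_mat hm (by rw [h2]; exact h1)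
      have ph : ∀ c : Fin 3, (pi2 V).toFun (h ((F3 V).evalTrm (upd w' i x z (gen V c)) T)) =
          (F2 V).evalTrm (fun o : Option (Fin 3) => o.elim
            ((F2 V).evalTrm (upd w' i (gx V) (gy V) (![gx V, gy V, gy V] c)) T)
              ![gx V, gy V, gy V]) g := by
        intro c
        unfold pi2
        rw [hg, ev_eval]
        congr 1
        funext o
        cases o with
        | none =>
          simp only [Option.elim]
          rw [ev_eval]
          congr 1
          funext j
          unfold upd
          split_ifs
          · rfl
          · cases w' j <;> rfl
        | some v => rfl
      have p0 := ph 0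
      have p1 := ph 1
      show (kap V).rel ((pi2 V).toFun (h ((F3 V).evalTrm (upd w' i x z (gen V 0)) T)))
        ((pi2 V).toFun (h ((F3 V).evalTrm (upd w' i x z (gen V 1)) T)))
      rw [p0, p1]
      exact h3
  -- use commutativity
  have hm : Mat (thetaC V (Fin 3)) (alp V) ((F3 V).evalTrm (upd w' i x z x) T)
      ((F3 V).evalTrm (upd w' i x z y) T) ((F3 V).evalTrm (upd w' i x x x) T)
      ((F3 V).evalTrm (upd w' i x x y) T) := by
    apply Mat.eval
    intro j
    unfold upd
    split_ifs
    · exact Mat.horiz (fun A hA a b => rfl)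
    · cases w' j <;> exact Mat.vert (fun A hA c => rfl)
  have h1 := centralizes_iff.1 (psi_central' hV) _ _ _ _ hm hpsi
  have hx : (F3 V).evalTrm (upd w' i x x x) T = x := by
    rw [updw']
    have : (fun j => cond (w' j) x x) = fun _ => x := by
      funext j; cases w' j <;> rfl
    rw [this]
    exact hid _ (FA_mem V _) x
  rw [hx] at h1
  have h2 := h1.2 _ Poly.id (fun A hA a b => rfl)
  have h3 : (pi2 V).toFun ((F3 V).evalTrm (upd w' i x x y) T) =
      (F2 V).evalTrm (fun j => if j = i then gy V else gx V) T := by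
    unfold pi2
    rw [ev_eval]
    congr 1
    funext j
    unfold upd
    split_ifs
    · rfl
    · cases w' j <;> rfl
  rw [← h3]
  exact h2

theorem diff_of_taylor {V : Variety σ} (hTay : HasTaylorTrm V)
    (hV : ∀ A : Alg σ, V.Mem A → ∀ x y : Congruence A, x ≤ y → commC x y = commC y x) :
    ∃ d : Trm σ (Fin 3), IsDifferenceTrm V d := by
  obtain ⟨n, T, hn, hid, hT⟩ := hTay
  have hF := FA_mem V Bool
  apply diff_of_kap
  have step : ∀ i : Fin n,
      (kap V).rel (gx V) ((F2 V).evalTrm (fun j => if j = i then gy V else gx V) T) := by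
    intro i
    obtain ⟨w, z, hwz, h⟩ := hT i
    cases hw : w i with
    | false =>
      have hz : z i = true := by cases hz : z i <;> simp_all
      exact taylor_dep hV hid i w z hw hz h
    | true =>
      have hz : z i = false := by cases hz : z i <;> simp_all
      exact taylor_dep hV hid i z w hz hw (fun A hA x y => (h A hA x y).symm)
  have key : ∀ s : Finset (Fin n),
      (kap V).rel (gx V) ((F2 V).evalTrm (fun j => if j ∈ s then gy V else gx V) T) := by
    intro s
    induction s using Finset.induction_on with
    | empty =>
      simp only [Finset.notMem_empty, if_false]
      rw [hid _ hF]
      exact (kap V).iseqv.refl _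
    | insert i s hi ih =>
      refine (kap V).iseqv.trans ih ?_
      have hm : Mat (th V) (th V)
          ((F2 V).evalTrm (fun _ => gx V) T)
          ((F2 V).evalTrm (fun j => if j = i then gy V else gx V) T)
          ((F2 V).evalTrm (fun j => if j ∈ s then gy V else gx V) T)
          ((F2 V).evalTrm (fun j => if j ∈ insert i s then gy V else gx V) T) := by
        apply Mat.eval
        intro j
        by_cases hj : j = i
        · subst hj
          simp only [if_neg hi, if_true, Finset.mem_insert_self]
          exact Mat.horiz (th_gen V _ _)
        · by_cases hs : j ∈ s
          · simp only [hj, hs, if_true, if_false, Finset.mem_insert, or_true]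
            exact Mat.vert (th_gen V _ _)
          · simp only [hj, hs, if_false, Finset.mem_insert, or_false]
            exact Mat.const _
      refine kap_mat hm ?_
      rw [hid _ hF]
      exact step i
  have := key Finset.univ
  simp only [Finset.mem_univ, if_true] at this
  rw [hid _ hF] at this
  exact (kap V).iseqv.symm this

/-! From a difference term to a Taylor term -/

def IdemT (V : Variety σ) {I : Type} (S : Trm σ I) : Prop :=
  ∀ A : Alg σ, V.Mem A → ∀ c : A.carrier, A.evalTrm (fun _ => c) S = c

def Above (V : Variety σ) {K I : Type} (T : Trm σ K) (S : Trm σ I) : Prop :=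
  ∃ ρ : K → I, sat V (T.bind (fun k => Trm.var (ρ k))) S

def star {I J : Type} (S₁ : Trm σ I) (S₂ : Trm σ J) : Trm σ (I × J) :=
  S₁.bind (fun i => S₂.bind (fun j => Trm.var (i, j)))

noncomputable def eF (V : Variety σ) {K : Type} (w : K → Bool) (T : Trm σ K) : (F2 V).carrier :=
  (F2 V).evalTrm (fun k => gen V (w k)) T

def Good (V : Variety σ) {K : Type} (T : Trm σ K) (i : K) : Prop :=
  ∀ w z : K → Bool, eF V w T = eF V z T → w i = z i

theorem Above.trans {V : Variety σ} {I J K : Type} {T : Trm σ I} {S : Trm σ J} {R : Trm σ K}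
    (h₁ : Above V T S) (h₂ : Above V S R) : Above V T R := by
  obtain ⟨ρ, h₁⟩ := h₁
  obtain ⟨τ, h₂⟩ := h₂
  refine ⟨fun i => τ (ρ i), fun A hA asg => ?_⟩
  rw [← h₂ A hA asg, eval_bind, eval_bind]
  have := h₁ A hA (fun j => asg (τ j))
  rw [eval_bind] at this
  exact this

theorem star_idem {V : Variety σ} {I J : Type} {S₁ : Trm σ I} {S₂ : Trm σ J}
    (h₁ : IdemT V S₁) (h₂ : IdemT V S₂) : IdemT V (star S₁ S₂) := by
  intro A hA c
  unfold star
  rw [eval_bind]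
  simp only [eval_bind, eval_var]
  rw [h₂ A hA c, h₁ A hA c]

theorem star_left {V : Variety σ} {I J : Type} {S₁ : Trm σ I} {S₂ : Trm σ J}
    (h₂ : IdemT V S₂) : Above V (star S₁ S₂) S₁ := by
  refine ⟨Prod.fst, fun A hA asg => ?_⟩
  unfold star
  simp only [eval_bind, eval_var]
  congr 1
  funext i
  exact h₂ A hA _

theorem star_right {V : Variety σ} {I J : Type} {S₁ : Trm σ I} {S₂ : Trm σ J}
    (h₁ : IdemT V S₁) : Above V (star S₁ S₂) S₂ := by
  refine ⟨Prod.snd, fun A hA asg => ?_⟩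
  unfold star
  simp only [eval_bind, eval_var]
  exact h₁ A hA _

theorem eF_above {V : Variety σ} {K I : Type} {T : Trm σ K} {S : Trm σ I} {ρ : K → I}
    (h : sat V (T.bind (fun k => Trm.var (ρ k))) S) (φ : I → Bool) :
    eF V (fun k => φ (ρ k)) T = eF V φ S := by
  have := h _ (FA_mem V Bool) (fun k => gen V (φ k))
  rw [eval_bind] at this
  exact this

def QQ (V : Variety σ) (p q : (F2 V).carrier) : Prop :=
  ∃ (I : Type) (_ : Finite I) (S : Trm σ I), IdemT V S ∧
    ∀ (K : Type) (T : Trm σ K), IdemT V T → Above V T S → ∀ w w' : K → Bool,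
      eF V w T = p → eF V w' T = q → ∀ i, Good V T i → w i = w' i

theorem idem_term {V : Variety σ} {p : (F2 V).carrier} (hp : IdemE V p) :
    ∃ s : Trm σ Bool, IdemT V s ∧ p = eF V id s := by
  obtain ⟨s, hs⟩ := FA_exists V p
  refine ⟨s, fun A hA c => ?_, hs⟩
  have := hp A hA c
  rw [hs, ev_eval] at this
  exact this

theorem QQ_refl {V : Variety σ} (p : (F2 V).carrier) : QQ V p p :=
  ⟨Unit, inferInstance, Trm.var (), fun _ _ _ => rfl,
    fun _ _ _ _ w w' h h' i hi => hi w w' (h.trans h'.symm)⟩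

theorem QQ_symm {V : Variety σ} {p q : (F2 V).carrier} (h : QQ V p q) : QQ V q p := by
  obtain ⟨I, hI, S, hS, h⟩ := h
  exact ⟨I, hI, S, hS, fun K T hT hTS w w' e e' i hi => (h K T hT hTS w' w e' e i hi).symm⟩

theorem QQ_trans {V : Variety σ} {p q r : (F2 V).carrier} (hq : IdemE V q)
    (h : QQ V p q) (h' : QQ V q r) : QQ V p r := by
  obtain ⟨I, hI, S, hS, h⟩ := h
  obtain ⟨I', hI', S', hS', h'⟩ := h'
  obtain ⟨s, hs, rfl⟩ := idem_term hq
  refine ⟨(I × I') × Bool, inferInstance, star (star S S') s, star_idem (star_idem hS hS') hs, ?_⟩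
  intro K T hT hTS w w' e e' i hi
  have h1 := hTS.trans (star_left hs)
  obtain ⟨ρ, hρ⟩ := hTS.trans (star_right (star_idem hS hS'))
  have hv := eF_above hρ id
  exact (h K T hT (h1.trans (star_left hS')) w _ e hv i hi).trans
    (h' K T hT (h1.trans (star_right hS)) _ w' hv e' i hi)

noncomputable def EE (V : Variety σ) : Congruence (F2 V) :=
  bigCong (th V) (IdemE V) (QQ V) (fun _ _ h hp => IdemE.sat h hp) (fun a _ => QQ_refl a)
    (fun _ _ _ _ => QQ_symm) (fun _ _ _ _ hq _ => QQ_trans hq)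

/-- the term of a matrix entry, with separated variables -/
def sep {m n : ℕ} (t : Trm σ (Sum (Fin m) (Fin n))) (a : Fin m → Trm σ Bool)
    (u : Fin n → Trm σ Bool) : Trm σ (Bool × Bool) :=
  t.bind (Sum.elim (fun i => (a i).bind (fun x => Trm.var (false, x)))
    (fun j => (u j).bind (fun x => Trm.var (true, x))))

theorem sep_eval (A : Alg σ) {m n : ℕ} (t : Trm σ (Sum (Fin m) (Fin n))) (a : Fin m → Trm σ Bool)
    (u : Fin n → Trm σ Bool) (asg : Bool × Bool → A.carrier) :
    A.evalTrm asg (sep t a u) = A.evalTrm (Sum.elim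
      (fun i => A.evalTrm (fun x => asg (false, x)) (a i))
      (fun j => A.evalTrm (fun x => asg (true, x)) (u j))) t := by
  unfold sep
  rw [eval_bind]
  congr 1
  funext o
  cases o with
  | inl i => exact eval_bind _ _ _ _
  | inr i => exact eval_bind _ _ _ _

theorem sep_snd {V : Variety σ} {m n : ℕ} (t : Trm σ (Sum (Fin m) (Fin n)))
    (a : Fin m → Trm σ Bool) (u : Fin n → Trm σ Bool) :
    eF V Prod.snd (sep t a u) = (F2 V).evalTrm (Sum.elim
      (fun i => (F2 V).evalTrm (fun x => gen V x) (a i))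
      (fun j => (F2 V).evalTrm (fun x => gen V x) (u j))) t :=
  sep_eval _ _ _ _ _

theorem sep_idem {V : Variety σ} {m n : ℕ} {t : Trm σ (Sum (Fin m) (Fin n))}
    {a : Fin m → Trm σ Bool} {u : Fin n → Trm σ Bool}
    (h : IdemE V (eF V Prod.snd (sep t a u))) : IdemT V (sep t a u) := by
  intro A hA c
  have := h A hA c
  unfold eF at this
  rw [ev_eval] at this
  exact this

theorem sep_right {V : Variety σ} {m n : ℕ} (t : Trm σ (Sum (Fin m) (Fin n)))
    (a : Fin m → Trm σ Bool) {u v : Fin n → Trm σ Bool}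
    (huv : ∀ j, ∀ A : Alg σ, V.Mem A → ∀ c : A.carrier,
      A.evalTrm (fun _ => c) (u j) = A.evalTrm (fun _ => c) (v j))
    (φ : Bool × Bool → Bool) (c : Bool) (hφ : ∀ x, φ (true, x) = c) :
    eF V φ (sep t a u) = eF V φ (sep t a v) := by
  unfold eF
  rw [sep_eval, sep_eval]
  congr 1
  funext o
  cases o with
  | inl i => rfl
  | inr j =>
    simp only [Sum.elim_inr, hφ]
    exact huv j _ (FA_mem V Bool) _

theorem sep_left {V : Variety σ} {m n : ℕ} (t : Trm σ (Sum (Fin m) (Fin n)))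
    {a b : Fin m → Trm σ Bool} (u : Fin n → Trm σ Bool)
    (hab : ∀ j, ∀ A : Alg σ, V.Mem A → ∀ c : A.carrier,
      A.evalTrm (fun _ => c) (a j) = A.evalTrm (fun _ => c) (b j))
    (φ : Bool × Bool → Bool) (c : Bool) (hφ : ∀ x, φ (false, x) = c) :
    eF V φ (sep t a u) = eF V φ (sep t b u) := by
  unfold eF
  rw [sep_eval, sep_eval]
  congr 1
  funext o
  cases o with
  | inr i => rfl
  | inl j =>
    simp only [Sum.elim_inl, hφ]
    exact hab j _ (FA_mem V Bool) _

theorem th_terms {V : Variety σ} {s t : Trm σ Bool}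
    (h : (th V).rel ((F2 V).evalTrm (fun x => gen V x) s) ((F2 V).evalTrm (fun x => gen V x) t)) :
    ∀ A : Alg σ, V.Mem A → ∀ c : A.carrier,
      A.evalTrm (fun _ => c) s = A.evalTrm (fun _ => c) t := by
  intro A hA c
  have := h A hA c
  rw [ev_eval, ev_eval] at this
  exact this

theorem QQ_step {V : Variety σ} {p q r s : (F2 V).carrier} (hm : Mat (th V) (th V) p q r s)
    (hp : IdemE V p) (hq : IdemE V q) (hr : IdemE V r) (hs : IdemE V s) (h : QQ V p q) :
    QQ V r s := by
  obtain ⟨m, n, t, a, b, u, v, hab, huv, e1, e2, e3, e4⟩ := hm.form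
  choose a' ha' using fun i => FA_exists V (a i)
  choose b' hb' using fun i => FA_exists V (b i)
  choose u' hu' using fun i => FA_exists V (u i)
  choose v' hv' using fun i => FA_exists V (v i)
  obtain rfl : a = fun i => _ := funext ha'
  obtain rfl : b = fun i => _ := funext hb'
  obtain rfl : u = fun i => _ := funext hu'
  obtain rfl : v = fun i => _ := funext hv'
  have hab' := fun i => th_terms (hab i)
  have huv' := fun i => th_terms (huv i)
  rw [← sep_snd] at e1 e2 e3 e4
  subst e1 e2 e3 e4
  have iP := sep_idem hp
  have iQ := sep_idem hq
  have iR := sep_idem hr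
  have iS := sep_idem hs
  obtain ⟨I, hI, S, hS, h⟩ := h
  have j1 := star_idem hS iP
  have j2 := star_idem j1 iQ
  have j3 := star_idem j2 iR
  refine ⟨_, inferInstance, _, star_idem j3 iS, ?_⟩
  intro K T hT hTS w w' hw hw' i hi
  obtain ⟨ρS, rS⟩ := hTS.trans (star_right j3)
  have k3 := hTS.trans (star_left iS)
  obtain ⟨ρR, rR⟩ := k3.trans (star_right j2)
  have k2 := k3.trans (star_left iR)
  obtain ⟨ρQ, rQ⟩ := k2.trans (star_right j1)
  have k1 := k2.trans (star_left iQ)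
  obtain ⟨ρP, rP⟩ := k1.trans (star_right hS)
  have k0 := k1.trans (star_left iP)
  have wR := hi w (fun k => (ρR k).2) (hw.trans (eF_above rR Prod.snd).symm)
  have wS := hi w' (fun k => (ρS k).2) (hw'.trans (eF_above rS Prod.snd).symm)
  have hPQ := h K T hT k0 (fun k => (ρP k).2) (fun k => (ρQ k).2) (eF_above rP Prod.snd)
    (eF_above rQ Prod.snd) i hi
  have PQ : ∀ (φ : Bool × Bool → Bool) (c : Bool), (∀ x, φ (true, x) = c) →
      φ (ρP i) = φ (ρQ i) := fun φ c hφ => hi (fun k => φ (ρP k)) (fun k => φ (ρQ k)) (by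
    rw [eF_above rP, eF_above rQ]; exact sep_right t _ huv' φ c hφ)
  have RS : ∀ (φ : Bool × Bool → Bool) (c : Bool), (∀ x, φ (true, x) = c) →
      φ (ρR i) = φ (ρS i) := fun φ c hφ => hi (fun k => φ (ρR k)) (fun k => φ (ρS k)) (by
    rw [eF_above rR, eF_above rS]; exact sep_right t _ huv' φ c hφ)
  have PR : ∀ (φ : Bool × Bool → Bool) (c : Bool), (∀ x, φ (false, x) = c) →
      φ (ρP i) = φ (ρR i) := fun φ c hφ => hi (fun k => φ (ρP k)) (fun k => φ (ρR k)) (by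
    rw [eF_above rP, eF_above rR]; exact sep_left t _ hab' φ c hφ)
  have QS : ∀ (φ : Bool × Bool → Bool) (c : Bool), (∀ x, φ (false, x) = c) →
      φ (ρQ i) = φ (ρS i) := fun φ c hφ => hi (fun k => φ (ρQ k)) (fun k => φ (ρS k)) (by
    rw [eF_above rQ, eF_above rS]; exact sep_left t _ hab' φ c hφ)
  have f1 := RS Prod.fst true (fun _ => rfl)
  have f2 := RS (fun x => !x.1 && x.2) false (fun _ => rfl)
  have f3 := PR Prod.fst false (fun _ => rfl)
  have f4 := PR (fun x => x.1 && x.2) false (fun _ => rfl)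
  have f5 := QS Prod.fst false (fun _ => rfl)
  have f6 := QS (fun x => x.1 && x.2) false (fun _ => rfl)
  rw [wR, wS]
  generalize ρP i = P at *
  generalize ρQ i = Q at *
  generalize ρR i = R at *
  generalize ρS i = S' at *
  obtain ⟨P1, P2⟩ := P
  obtain ⟨Q1, Q2⟩ := Q
  obtain ⟨R1, R2⟩ := R
  obtain ⟨S1, S2⟩ := S'
  clear PQ RS PR QS
  simp only at *
  subst f1 f3 f5 hPQ
  clear wR wS
  revert f2 f4 f6
  revert P2 Q1 R2 S2
  decide

theorem EE_central (V : Variety σ) : Centralizes (th V) (th V) (EE V) := by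
  apply bigCong_centralizes
  intro p q r s hm hp hq hr hs h
  exact QQ_step hm hp hq hr hs h

theorem taylor_finite {V : Variety σ} {d : Trm σ (Fin 3)} (hd : IsDifferenceTrm V d) :
    ∃ (I : Type) (_ : Finite I) (T : Trm σ I), IdemT V T ∧ ∀ i, ¬ Good V T i := by
  have hF := FA_mem V Bool
  have hE : (EE V).rel _ (gx V) := commC_le (EE_central V) _ _
    (diff_rel hd hF (commC_le_left (th V) (th V)) (centralizes_commC _ _) (th_gen V true false))
  have hdi : IdemT V d := by
    intro A hA c
    have := hd.1 A hA c c
    refine Eq.trans ?_ this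
    congr 1
    funext i
    fin_cases i <;> rfl
  have hid : IdemE V ((F2 V).evalTrm ![gen V true, gen V false, gen V false] d) := by
    intro A hA c
    rw [ev_eval]
    refine Eq.trans ?_ (hdi A hA c)
    congr 1
    funext i
    fin_cases i <;> rfl
  obtain ⟨I, hI, S, hS, h⟩ := hE.2 _ Poly.id hid
  refine ⟨I × Fin 3, inferInstance, star S d, star_idem hS hdi, ?_⟩
  intro i hi
  obtain ⟨ρ, hρ⟩ := star_right (V := V) (S₂ := d) hS
  have c1 := h _ _ (star_idem hS hdi) (star_left hdi)
    (fun k => (![true, false, false] : Fin 3 → Bool) (ρ k)) (fun _ => true)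
    (by
      rw [eF_above hρ]
      unfold eF
      congr 1
      funext i
      fin_cases i <;> rfl)
    (star_idem hS hdi _ hF _) i hi
  have c2 := hi (fun k => (![true, true, false] : Fin 3 → Bool) (ρ k)) (fun _ => false) (by
    rw [eF_above hρ]
    refine Eq.trans ?_ (star_idem hS hdi _ hF (gy V)).symm
    refine Eq.trans ?_ (hd.1 _ hF (gx V) (gy V))
    unfold eF
    congr 1
    funext i
    fin_cases i <;> rfl)
  generalize ρ i = k at *
  fin_cases k <;> simp at c1 c2

theorem taylor_of_diff {V : Variety σ} {d : Trm σ (Fin 3)} (hd : IsDifferenceTrm V d) :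
    HasTaylorTrm V := by
  obtain ⟨I, hI, T, hT, hG⟩ := taylor_finite hd
  obtain ⟨n, ⟨e⟩⟩ := Finite.exists_equiv_fin I
  have bnd : ∀ (A : Alg σ) (asg : Fin (n + 1) → A.carrier),
      A.evalTrm asg (T.bind (fun i => Trm.var (e i).castSucc)) =
      A.evalTrm (fun i => asg (e i).castSucc) T := fun A asg => eval_bind _ _ _ _
  refine ⟨n + 1, T.bind (fun i => Trm.var (e i).castSucc), Nat.succ_pos n, ?_, ?_⟩
  · intro A hA c
    rw [bnd]
    exact hT A hA c
  · intro i
    induction i using Fin.lastCases with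
    | last =>
      refine ⟨fun _ => false, fun j => decide (j = Fin.last n), by simp, ?_⟩
      intro A hA x y
      rw [bnd, bnd]
      congr 1
      funext j
      have : (e j).castSucc ≠ Fin.last n := (Fin.castSucc_lt_last _).ne
      simp [this]
    | cast i =>
      have := hG (e.symm i)
      unfold Good at this
      push Not at this
      obtain ⟨w, z, hwz, hne⟩ := this
      refine ⟨Fin.lastCases false (fun j => w (e.symm j)),
        Fin.lastCases false (fun j => z (e.symm j)), ?_, ?_⟩
      · simpa using hne
      · intro A hA x y
        rw [bnd, bnd]
        simp only [Fin.lastCases_castSucc, Equiv.symm_apply_apply]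
        have := congrArg (ev hA (fun v : Bool => cond v x y)).toFun hwz
        unfold eF at this
        rw [ev_eval, ev_eval] at this
        exact this

end UA

/-- For a variety `V`, the following are equivalent: (1) `V` has a difference
term; (2) `V` has a Taylor term and commutative commutator; (3) `V` has a
Taylor term and the commutator is commutative on comparable pairs. -/
theorem difference_term_iff_taylor_and_commutative {σ : Sig} (V : Variety σ) :
    List.TFAE [
      ∃ d : Trm σ (Fin 3), IsDifferenceTrm V d,
      HasTaylorTrm V ∧ CommutativeCommutator V,
      HasTaylorTrm V ∧ ∀ A : Alg σ, V.Mem A → ∀ x y : Congruence A, x ≤ y →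
        commC x y = commC y x ] := by
  tfae_have 1 → 2 := by
    rintro ⟨d, hd⟩
    exact ⟨UA.taylor_of_diff hd, fun A hA x y =>
      le_antisymm (UA.diff_comm_le hd hA y x) (UA.diff_comm_le hd hA x y)⟩
  tfae_have 2 → 3 := fun h => ⟨h.1, fun A hA x y _ => h.2 A hA x y⟩
  tfae_have 3 → 1 := fun h => UA.diff_of_taylor h.1 h.2
  tfae_finish
end

section
/- If a variety V has a Taylor term, then the commutator operation in V is left distributive ([x + y, z] = [x,z] + [y,z] throughout V) if and only if it is right distributive ([x, y + z] = [x,y] + [x,z] throughout V). Moreover, if either distributivity condition holds, then the commutator is commutative throughout V. -/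
namespace DC

variable {σ : Sig}

/-- Substitution of terms for variables. -/
def tsub {V W : Type} (s : V → Trm σ W) : Trm σ V → Trm σ W
  | .var v => s v
  | .op f ts => .op f (fun i => tsub s (ts i))

theorem eval_tsub (A : Alg σ) {V W : Type} (s : V → Trm σ W) (asg : W → A.carrier)
    (t : Trm σ V) :
    A.evalTrm asg (tsub s t) = A.evalTrm (fun v => A.evalTrm asg (s v)) t := by
  induction t with
  | var v => rfl
  | op f ts ih =>
    simp only [tsub, Alg.evalTrm]
    congr 1
    funext i
    exact ih i

theorem rel_eval {A : Alg σ} (c : Congruence A) {V : Type} (a b : V → A.carrier)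
    (h : ∀ v, c.rel (a v) (b v)) (t : Trm σ V) :
    c.rel (A.evalTrm a t) (A.evalTrm b t) := by
  induction t with
  | var v => exact h v
  | op f ts ih => exact c.compat f _ _ ih

theorem hom_eval {A B : Alg σ} (h : UAHom A B) {V : Type} (a : V → A.carrier)
    (t : Trm σ V) :
    h.toFun (A.evalTrm a t) = B.evalTrm (fun v => h.toFun (a v)) t := by
  induction t with
  | var v => rfl
  | op f ts ih =>
    simp only [Alg.evalTrm]
    rw [h.map_op]
    congr 1
    funext i
    exact ih i

/-- Preimage of a congruence under a homomorphism. -/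
def pull {A B : Alg σ} (h : UAHom A B) (c : Congruence B) : Congruence A where
  rel a b := c.rel (h.toFun a) (h.toFun b)
  iseqv := ⟨fun _ => c.iseqv.refl _, fun h => c.iseqv.symm h, fun h k => c.iseqv.trans h k⟩
  compat f a b hab := by
    rw [h.map_op, h.map_op]
    exact c.compat f _ _ hab

theorem inf_rel {A : Alg σ} (c d : Congruence A) (a b : A.carrier) :
    (c ⊓ d).rel a b ↔ c.rel a b ∧ d.rel a b := by
  constructor
  · intro h
    exact ⟨(inf_le_left : c ⊓ d ≤ c) a b h, (inf_le_right : c ⊓ d ≤ d) a b h⟩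
  · intro h
    let m : Congruence A :=
      { rel := fun a b => c.rel a b ∧ d.rel a b
        iseqv := ⟨fun a => ⟨c.iseqv.refl a, d.iseqv.refl a⟩,
          fun h => ⟨c.iseqv.symm h.1, d.iseqv.symm h.2⟩,
          fun h k => ⟨c.iseqv.trans h.1 k.1, d.iseqv.trans h.2 k.2⟩⟩
        compat := fun f a b h => ⟨c.compat f a b fun i => (h i).1,
          d.compat f a b fun i => (h i).2⟩ }
    have hm : m ≤ c ⊓ d := le_inf (fun a b h => h.1) (fun a b h => h.2)
    exact hm a b h

theorem sup_l {A : Alg σ} (c d : Congruence A) {a b : A.carrier} (h : c.rel a b) :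
    (c ⊔ d).rel a b := (le_sup_left : c ≤ c ⊔ d) a b h

theorem sup_r {A : Alg σ} (c d : Congruence A) {a b : A.carrier} (h : d.rel a b) :
    (c ⊔ d).rel a b := (le_sup_right : d ≤ c ⊔ d) a b h

/-- The congruence generated by a relation. -/
def cg (A : Alg σ) (R : A.carrier → A.carrier → Prop) : Congruence A :=
  sInf {c | ∀ a b, R a b → c.rel a b}

theorem cg_le {A : Alg σ} {R : A.carrier → A.carrier → Prop} {c : Congruence A}
    (h : ∀ a b, R a b → c.rel a b) : cg A R ≤ c := sInf_le h

theorem cg_of {A : Alg σ} {R : A.carrier → A.carrier → Prop} {a b : A.carrier}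
    (h : R a b) : (cg A R).rel a b := fun _ hc => hc a b h

/-- polynomial evaluation -/
def pev (A : Alg σ) (a : A.carrier) (t : Trm σ (Option A.carrier)) : A.carrier :=
  A.evalTrm (fun o => o.elim a id) t

/-- The syntactic congruence of a predicate: the largest congruence saturating it. -/
def syn (A : Alg σ) (P : A.carrier → Prop) : Congruence A where
  rel a b := ∀ t, P (pev A a t) ↔ P (pev A b t)
  iseqv := ⟨fun _ _ => Iff.rfl, fun h t => (h t).symm, fun h k t => (h t).trans (k t)⟩
  compat f a b hab := by
    intro t
    have key : ∀ s : Finset (Fin (σ.arity f)),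
        P (pev A (A.interp f a) t) ↔
          P (pev A (A.interp f (fun i => if i ∈ s then b i else a i)) t) := by
      intro s
      induction s using Finset.induction_on with
      | empty => simp
      | insert j s hj ih =>
        rw [ih]
        -- polynomial in the `j`-th coordinate
        have := hab j (tsub (fun o : Option A.carrier => o.elim
          (Trm.op f (fun i => if i = j then .var none
            else .var (some (if i ∈ s then b i else a i)))) (fun c => .var (some c))) t)
        have e : ∀ c, pev A c (tsub (fun o : Option A.carrier => o.elim
          (Trm.op f (fun i => if i = j then .var none
            else .var (some (if i ∈ s then b i else a i)))) (fun c => .var (some c))) t)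
            = pev A (A.interp f (fun i => if i = j then c
                else if i ∈ s then b i else a i)) t := by
          intro c
          unfold pev
          rw [eval_tsub]
          congr 1
          funext o
          cases o with
          | none =>
            simp only [Option.elim, Alg.evalTrm]
            congr 1
            funext i
            split_ifs <;> rfl
          | some c => rfl
        rw [e, e] at this
        have e1 : (fun i => if i = j then a j else if i ∈ s then b i else a i)
            = (fun i => if i ∈ s then b i else a i) := by
          funext i
          by_cases h : i = j
          · subst h; simp [hj]
          · simp [h]
        have e2 : (fun i => if i = j then b j else if i ∈ s then b i else a i)
            = (fun i => if i ∈ insert j s then b i else a i) := by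
          funext i
          by_cases h : i = j
          · subst h; simp
          · simp [h]
        rw [e1, e2] at this
        exact this
    have := key Finset.univ
    simpa using this

theorem le_syn {A : Alg σ} {P : A.carrier → Prop} {c : Congruence A}
    (h : ∀ a b, c.rel a b → P a → P b) : c ≤ syn A P := by
  intro a b hab t
  have : c.rel (pev A a t) (pev A b t) := rel_eval c _ _ (fun o => by
    cases o with
    | none => exact hab
    | some d => exact c.iseqv.refl d) t
  exact ⟨h _ _ this, h _ _ (c.iseqv.symm this)⟩

theorem syn_sat {A : Alg σ} {P : A.carrier → Prop} {a b : A.carrier}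
    (h : (syn A P).rel a b) : P a → P b := (h (.var none)).1

theorem sup_sat {A : Alg σ} {P : A.carrier → Prop} {c d : Congruence A}
    (hc : ∀ a b, c.rel a b → P a → P b) (hd : ∀ a b, d.rel a b → P a → P b)
    {a b : A.carrier} (h : (c ⊔ d).rel a b) : P a → P b :=
  syn_sat ((sup_le (le_syn hc) (le_syn hd)) a b h)

theorem cg_sat {A : Alg σ} {P : A.carrier → Prop} {R : A.carrier → A.carrier → Prop}
    (hR : ∀ a b, R a b → ∀ t, P (pev A a t) ↔ P (pev A b t))
    {a b : A.carrier} (h : (cg A R).rel a b) : P a → P b :=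
  syn_sat ((cg_le (c := syn A P) hR) a b h)

/-! ### centralizer -/

theorem cent_mono {A : Alg σ} {S T S' T' δ : Congruence A} (h : Centralizes S T δ)
    (hS : S' ≤ S) (hT : T' ≤ T) : Centralizes S' T' δ :=
  fun m n t a b u v hab huv h0 =>
    h m n t a b u v (fun i => hS _ _ (hab i)) (fun j => hT _ _ (huv j)) h0

theorem cent_pull {A B : Alg σ} (f : UAHom A B) {S T δ : Congruence B}
    (h : Centralizes S T δ) : Centralizes (pull f S) (pull f T) (pull f δ) := by
  intro m n t a b u v hab huv h0
  have e : ∀ (x : Fin m → A.carrier) (y : Fin n → A.carrier),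
      f.toFun (A.evalTrm (Sum.elim x y) t)
        = B.evalTrm (Sum.elim (fun i => f.toFun (x i)) (fun i => f.toFun (y i))) t := by
    intro x y
    rw [hom_eval]
    congr 1
    funext o
    cases o <;> rfl
  simp only [pull, e] at h0 ⊢
  exact h m n t _ _ _ _ hab huv h0

theorem cent_inf {A : Alg σ} {S T δ ε : Congruence A} (h : Centralizes S T δ)
    (k : Centralizes S T ε) : Centralizes S T (δ ⊓ ε) := by
  intro m n t a b u v hab huv h0
  rw [inf_rel] at h0 ⊢
  exact ⟨h m n t a b u v hab huv h0.1, k m n t a b u v hab huv h0.2⟩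

theorem cent_left {A : Alg σ} {S T δ : Congruence A} (h : S ≤ δ) : Centralizes S T δ := by
  intro m n t a b u v hab huv h0
  have e : ∀ y : Fin n → A.carrier, δ.rel (A.evalTrm (Sum.elim a y) t)
      (A.evalTrm (Sum.elim b y) t) := fun y => rel_eval δ _ _ (fun o => by
    cases o with
    | inl i => exact h _ _ (hab i)
    | inr j => exact δ.iseqv.refl _) t
  exact δ.iseqv.trans (δ.iseqv.symm (e u)) (δ.iseqv.trans h0 (e v))

theorem cent_right {A : Alg σ} {S T δ : Congruence A} (h : T ≤ δ) : Centralizes S T δ := by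
  intro m n t a b u v hab huv h0
  exact rel_eval δ _ _ (fun o => by
    cases o with
    | inl i => exact δ.iseqv.refl _
    | inr j => exact h _ _ (huv j)) t

theorem cent_meet {A : Alg σ} (S T : Congruence A) : Centralizes S T (S ⊓ T) :=
  cent_inf (cent_left le_rfl) (cent_right le_rfl)

theorem cent_comm {A : Alg σ} (S T : Congruence A) : Centralizes S T (commC S T) := by
  intro m n t a b u v hab huv h0 c hc
  exact hc m n t a b u v hab huv (h0 c hc)

theorem comm_le {A : Alg σ} {S T δ : Congruence A} (h : Centralizes S T δ) :
    commC S T ≤ δ := sInf_le h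

/-- every term uses only finitely many variables -/
theorem fin_vars {I J : Type} (t : Trm σ (I ⊕ J)) :
    ∃ (m n : ℕ) (t' : Trm σ (Fin m ⊕ Fin n)) (f : Fin m → I) (g : Fin n → J),
      tsub (fun o => .var (Sum.map f g o)) t' = t := by
  induction t with
  | var v =>
    cases v with
    | inl i => exact ⟨1, 0, .var (.inl 0), fun _ => i, Fin.elim0, rfl⟩
    | inr j => exact ⟨0, 1, .var (.inr 0), Fin.elim0, fun _ => j, rfl⟩
  | op o ts ih =>
    choose m n t' f g h using ih
    refine ⟨∑ i, m i, ∑ i, n i, .op o (fun i => tsub (fun s => .var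
      (Sum.map (fun k => finSigmaFinEquiv ⟨i, k⟩) (fun k => finSigmaFinEquiv ⟨i, k⟩) s)) (t' i)),
      fun k => f (finSigmaFinEquiv.symm k).1 (finSigmaFinEquiv.symm k).2,
      fun k => g (finSigmaFinEquiv.symm k).1 (finSigmaFinEquiv.symm k).2, ?_⟩
    simp only [tsub]
    congr 1
    funext i
    rw [← h i]
    generalize t' i = s
    induction s with
    | var v =>
      cases v with
      | inl v =>
        simp only [tsub, Sum.map_inl]
        congr 2
        exact congrArg (fun q : (Σ i, Fin (m i)) => f q.1 q.2)
          (finSigmaFinEquiv.symm_apply_apply ⟨i, v⟩)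
      | inr v =>
        simp only [tsub, Sum.map_inr]
        congr 2
        exact congrArg (fun q : (Σ i, Fin (n i)) => g q.1 q.2)
          (finSigmaFinEquiv.symm_apply_apply ⟨i, v⟩)
    | op o' ts' ihk =>
      simp only [tsub]
      congr 1
      funext k
      exact ihk k

/-- The centralizer relation, in flexible form: every variable is either a row variable
or a column variable. -/
theorem cent4 {A : Alg σ} {S T δ : Congruence A} (h : Centralizes S T δ) {W : Type}
    (t : Trm σ W) (a00 a01 a10 a11 : W → A.carrier)
    (hw : ∀ w, (a00 w = a01 w ∧ a10 w = a11 w ∧ S.rel (a00 w) (a10 w)) ∨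
      (a00 w = a10 w ∧ a01 w = a11 w ∧ T.rel (a00 w) (a01 w)))
    (h0 : δ.rel (A.evalTrm a00 t) (A.evalTrm a01 t)) :
    δ.rel (A.evalTrm a10 t) (A.evalTrm a11 t) := by
  classical
  let R : W → Prop := fun w =>
    a00 w = a01 w ∧ a10 w = a11 w ∧ S.rel (a00 w) (a10 w)
  let C : W → Prop := fun w =>
    a00 w = a10 w ∧ a01 w = a11 w ∧ T.rel (a00 w) (a01 w)
  let t1 : Trm σ ({w // R w} ⊕ {w // C w}) :=
    tsub (fun w => if hR : R w then .var (.inl ⟨w, hR⟩)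
      else .var (.inr ⟨w, (hw w).resolve_left hR⟩)) t
  obtain ⟨m, n, t', f, g, ht⟩ := fin_vars t1
  have e : ∀ (p : {w // R w} → A.carrier) (q : {w // C w} → A.carrier) (a : W → A.carrier),
      (∀ w, p w = a w) → (∀ w, q w = a w) →
      A.evalTrm (Sum.elim (fun i => p (f i)) (fun j => q (g j))) t' = A.evalTrm a t := by
    intro p q a hp hq
    have e1 : A.evalTrm (Sum.elim p q) t1 = A.evalTrm a t := by
      simp only [t1]
      rw [eval_tsub]
      congr 1
      funext w
      split_ifs with hR
      · exact hp ⟨w, hR⟩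
      · exact hq ⟨w, _⟩
    rw [← e1, ← ht, eval_tsub]
    congr 1
    funext o
    cases o <;> rfl
  have := h m n t' (fun i => a00 (f i)) (fun i => a10 (f i)) (fun j => a00 (g j))
    (fun j => a01 (g j)) (fun i => (f i).2.2.2) (fun j => (g j).2.2.2)
  rw [e (fun w => a00 w) (fun w => a00 w) a00 (fun _ => rfl) (fun _ => rfl),
    e (fun w => a00 w) (fun w => a01 w) a01 (fun w => w.2.1) (fun _ => rfl),
    e (fun w => a10 w) (fun w => a00 w) a10 (fun w => rfl) (fun w => w.2.1),
    e (fun w => a10 w) (fun w => a01 w) a11 (fun w => w.2.2.1) (fun w => w.2.2.1)] at this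
  exact this h0

end DC

namespace DC

variable {σ : Sig}

theorem q_out {A : Alg σ} (c : Congruence A) (a : A.carrier) :
    c.rel (Quotient.mk c.setoid a).out a := Quotient.mk_out (s := c.setoid) a

/-- the quotient map -/
noncomputable def qmk (A : Alg σ) (c : Congruence A) : UAHom A (quotAlg A c) where
  toFun a := Quotient.mk c.setoid a
  map_op f a := Quotient.sound (s := c.setoid)
    (c.compat f _ _ fun i => c.iseqv.symm (q_out c (a i)))

theorem quot_mem (V : Variety σ) {A : Alg σ} (hA : V.Mem A) (c : Congruence A) :
    V.Mem (quotAlg A c) :=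
  V.closed_hom hA ⟨qmk A c, fun q => ⟨q.out, Quotient.out_eq q⟩⟩

/-- push-forward of a congruence above `c` -/
noncomputable def push {A : Alg σ} (c S : Congruence A) (h : c ≤ S) :
    Congruence (quotAlg A c) where
  rel p q := S.rel (Quotient.out p) (Quotient.out q)
  iseqv := ⟨fun _ => S.iseqv.refl _, fun h => S.iseqv.symm h, fun h k => S.iseqv.trans h k⟩
  compat f a b hab := by
    refine S.iseqv.trans (h _ _ (q_out c _)) (S.iseqv.trans ?_
      (S.iseqv.symm (h _ _ (q_out c _))))
    exact S.compat f _ _ hab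

theorem push_mk {A : Alg σ} {c S : Congruence A} (h : c ≤ S) (a b : A.carrier) :
    (push c S h).rel ((qmk A c).toFun a) ((qmk A c).toFun b) ↔ S.rel a b := by
  have ha := h _ _ (q_out c a)
  have hb := h _ _ (q_out c b)
  exact ⟨fun k => S.iseqv.trans (S.iseqv.symm ha) (S.iseqv.trans k hb),
    fun k => S.iseqv.trans ha (S.iseqv.trans k (S.iseqv.symm hb))⟩

theorem cent_push {A : Alg σ} {c S T P : Congruence A} (hS : c ≤ S) (hT : c ≤ T) (hP : c ≤ P)
    (h : Centralizes S T P) :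
    Centralizes (push c S hS) (push c T hT) (push c P hP) := by
  intro m n t a b u v hab huv h0
  have e : ∀ (x : Fin m → (quotAlg A c).carrier) (y : Fin n → (quotAlg A c).carrier),
      (quotAlg A c).evalTrm (Sum.elim x y) t = (qmk A c).toFun
        (A.evalTrm (Sum.elim (fun i => Quotient.out (x i)) (fun i => Quotient.out (y i))) t) := by
    intro x y
    rw [hom_eval]
    congr 1
    funext o
    cases o
    · exact (Quotient.out_eq _).symm
    · exact (Quotient.out_eq _).symm
  rw [e, e, push_mk] at h0 ⊢
  exact h m n t _ _ _ _ hab huv h0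

theorem stepA_left {V : Variety σ} (hD : CommLeftDistrib V) {A : Alg σ} (hA : V.Mem A)
    (c S1 S2 T P1 P2 : Congruence A) (h1 : c ≤ S1) (h2 : c ≤ S2) (h3 : c ≤ T)
    (h4 : c ≤ P1) (h5 : c ≤ P2) (k1 : Centralizes S1 T P1) (k2 : Centralizes S2 T P2) :
    ∃ Q, c ≤ Q ∧ Q ≤ P1 ⊔ P2 ∧ Centralizes (S1 ⊔ S2) T Q := by
  have h6 : c ≤ P1 ⊔ P2 := h4.trans le_sup_left
  refine ⟨pull (qmk A c) (commC (push c S1 h1 ⊔ push c S2 h2) (push c T h3)), ?_, ?_, ?_⟩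
  · intro a b hab
    have : (qmk A c).toFun a = (qmk A c).toFun b := Quotient.sound (s := c.setoid) hab
    show (commC _ _).rel _ _
    rw [this]
    exact (commC _ _).iseqv.refl _
  · intro a b hab
    have hab : (commC (push c S1 h1 ⊔ push c S2 h2) (push c T h3)).rel
      ((qmk A c).toFun a) ((qmk A c).toFun b) := hab
    rw [hD _ (quot_mem V hA c)] at hab
    have l1 : commC (push c S1 h1) (push c T h3) ≤ push c (P1 ⊔ P2) h6 :=
      (comm_le (cent_push h1 h3 h4 k1)).trans fun a b h => sup_l P1 P2 h
    have l2 : commC (push c S2 h2) (push c T h3) ≤ push c (P1 ⊔ P2) h6 :=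
      (comm_le (cent_push h2 h3 h5 k2)).trans fun a b h => sup_r P1 P2 h
    exact (push_mk h6 a b).1 ((sup_le l1 l2) _ _ hab)
  · refine cent_mono (cent_pull (qmk A c) (cent_comm _ _)) (sup_le ?_ ?_) ?_
    · exact fun a b h => sup_l _ _ ((push_mk h1 a b).2 h)
    · exact fun a b h => sup_r _ _ ((push_mk h2 a b).2 h)
    · exact fun a b h => ((push_mk h3 a b).2 h)

theorem stepA_right {V : Variety σ} (hD : CommRightDistrib V) {A : Alg σ} (hA : V.Mem A)
    (c S T1 T2 P1 P2 : Congruence A) (h1 : c ≤ T1) (h2 : c ≤ T2) (h3 : c ≤ S)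
    (h4 : c ≤ P1) (h5 : c ≤ P2) (k1 : Centralizes S T1 P1) (k2 : Centralizes S T2 P2) :
    ∃ Q, c ≤ Q ∧ Q ≤ P1 ⊔ P2 ∧ Centralizes S (T1 ⊔ T2) Q := by
  have h6 : c ≤ P1 ⊔ P2 := h4.trans le_sup_left
  refine ⟨pull (qmk A c) (commC (push c S h3) (push c T1 h1 ⊔ push c T2 h2)), ?_, ?_, ?_⟩
  · intro a b hab
    have : (qmk A c).toFun a = (qmk A c).toFun b := Quotient.sound (s := c.setoid) hab
    show (commC _ _).rel _ _
    rw [this]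
    exact (commC _ _).iseqv.refl _
  · intro a b hab
    have hab : (commC (push c S h3) (push c T1 h1 ⊔ push c T2 h2)).rel
      ((qmk A c).toFun a) ((qmk A c).toFun b) := hab
    rw [hD _ (quot_mem V hA c)] at hab
    have l1 : commC (push c S h3) (push c T1 h1) ≤ push c (P1 ⊔ P2) h6 :=
      (comm_le (cent_push h3 h1 h4 k1)).trans fun a b h => sup_l P1 P2 h
    have l2 : commC (push c S h3) (push c T2 h2) ≤ push c (P1 ⊔ P2) h6 :=
      (comm_le (cent_push h3 h2 h5 k2)).trans fun a b h => sup_r P1 P2 h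
    exact (push_mk h6 a b).1 ((sup_le l1 l2) _ _ hab)
  · refine cent_mono (cent_pull (qmk A c) (cent_comm _ _)) ?_ (sup_le ?_ ?_)
    · exact fun a b h => ((push_mk h3 a b).2 h)
    · exact fun a b h => sup_l _ _ ((push_mk h1 a b).2 h)
    · exact fun a b h => sup_r _ _ ((push_mk h2 a b).2 h)

/-- Consequence of either distributive law. -/
theorem stepA_star {V : Variety σ} (hD : CommLeftDistrib V ∨ CommRightDistrib V) {A : Alg σ}
    (hA : V.Mem A) (c γ s t : Congruence A) (hg : c ≤ γ) (hs : c ≤ s) (ht : c ≤ t)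
    (hst : γ ≤ s ⊔ t) :
    ∃ Q, c ≤ Q ∧ Q ≤ (s ⊓ γ) ⊔ (t ⊓ γ) ∧ Centralizes γ γ Q := by
  rcases hD with hD | hD
  · obtain ⟨Q, q1, q2, q3⟩ := stepA_left hD hA c s t γ (s ⊓ γ) (t ⊓ γ) hs ht hg
      (le_inf hs hg) (le_inf ht hg) (cent_meet _ _) (cent_meet _ _)
    exact ⟨Q, q1, q2, cent_mono q3 hst le_rfl⟩
  · obtain ⟨Q, q1, q2, q3⟩ := stepA_right hD hA c γ s t (γ ⊓ s) (γ ⊓ t) hs ht hg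
      (le_inf hg hs) (le_inf hg ht) (cent_meet _ _) (cent_meet _ _)
    exact ⟨Q, q1, by rwa [inf_comm s, inf_comm t], cent_mono q3 le_rfl hst⟩

end DC

namespace DC

variable {σ : Sig}

/-- term algebra -/
def tmAlg (σ : Sig) (X : Type) : Alg σ where
  carrier := Trm σ X
  interp f a := .op f a

theorem tm_eval {X Y : Type} (s : Y → Trm σ X) (t : Trm σ Y) :
    (tmAlg σ X).evalTrm s t = tsub s t := by
  induction t with
  | var v => rfl
  | op f ts ih =>
    simp only [tsub, Alg.evalTrm]
    exact congrArg (Trm.op f) (funext ih)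

theorem tsub_var {X : Type} (t : Trm σ X) : tsub (fun x => .var x) t = t := by
  induction t with
  | var v => rfl
  | op f ts ih =>
    simp only [tsub]
    exact congrArg (Trm.op f) (funext ih)

/-- identities of the variety -/
def idc (V : Variety σ) (X : Type) : Congruence (tmAlg σ X) where
  rel s t := ∀ A : Alg σ, V.Mem A → ∀ a : X → A.carrier, A.evalTrm a s = A.evalTrm a t
  iseqv := ⟨fun _ _ _ _ => rfl, fun h A hA a => (h A hA a).symm,
    fun h k A hA a => (h A hA a).trans (k A hA a)⟩
  compat f s t h A hA a := by
    show A.evalTrm a (.op f s) = A.evalTrm a (.op f t)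
    simp only [Alg.evalTrm]
    congr 1
    funext i
    exact h i A hA a

/-- free algebra -/
noncomputable def Free (V : Variety σ) (X : Type) : Alg σ := quotAlg (tmAlg σ X) (idc V X)

/-- generators -/
noncomputable def gen (V : Variety σ) {X : Type} (x : X) : (Free V X).carrier :=
  (qmk (tmAlg σ X) (idc V X)).toFun (.var x)

theorem gen_eval (V : Variety σ) {X : Type} (t : Trm σ X) :
    (Free V X).evalTrm (gen V) t = (qmk (tmAlg σ X) (idc V X)).toFun t := by
  have h := hom_eval (qmk (tmAlg σ X) (idc V X)) (fun x => .var x) t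
  rw [tm_eval, tsub_var] at h
  exact h.symm

/-- a term representing an element -/
noncomputable def rep {V : Variety σ} {X : Type} (q : (Free V X).carrier) : Trm σ X :=
  Quotient.out (s := (idc V X).setoid) q

theorem rep_eval {V : Variety σ} {X : Type} (q : (Free V X).carrier) :
    (Free V X).evalTrm (gen V) (rep q) = q := by
  rw [gen_eval]
  exact Quotient.out_eq (s := (idc V X).setoid) q

theorem free_id {V : Variety σ} {X : Type} {s t : Trm σ X}
    (h : (Free V X).evalTrm (gen V) s = (Free V X).evalTrm (gen V) t)
    {A : Alg σ} (hA : V.Mem A) (a : X → A.carrier) : A.evalTrm a s = A.evalTrm a t := by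
  rw [gen_eval, gen_eval] at h
  exact Quotient.exact (s := (idc V X).setoid) h A hA a

/-- universal property -/
noncomputable def lift {V : Variety σ} {X : Type} {A : Alg σ} (hA : V.Mem A)
    (a : X → A.carrier) : UAHom (Free V X) A where
  toFun q := A.evalTrm a (rep q)
  map_op f q := by
    have : A.evalTrm a (rep ((Free V X).interp f q))
        = A.evalTrm a (.op f (fun i => rep (q i))) := by
      apply free_id _ hA
      rw [rep_eval]
      simp only [Alg.evalTrm, rep_eval]
    exact this

theorem lift_eval {V : Variety σ} {X : Type} {A : Alg σ} (hA : V.Mem A)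
    (a : X → A.carrier) (t : Trm σ X) :
    (lift hA a).toFun ((Free V X).evalTrm (gen V) t) = A.evalTrm a t :=
  free_id (rep_eval _) hA a

theorem free_mem (V : Variety σ) (X : Type) : V.Mem (Free V X) := by
  classical
  let I := {p : Trm σ X × Trm σ X // ¬ (idc V X).rel p.1 p.2}
  have hI : ∀ i : I, ∃ A : Alg σ, V.Mem A ∧ ∃ a : X → A.carrier,
      A.evalTrm a i.1.1 ≠ A.evalTrm a i.1.2 := by
    intro i
    have := i.2
    simp only [idc] at this
    push Not at this
    obtain ⟨A, hA, a, h⟩ := this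
    exact ⟨A, hA, a, h⟩
  choose A hA a ha using hI
  refine V.closed_sub (V.closed_prod A hA) ⟨⟨fun q i => (lift (hA i) (a i)).toFun q, ?_⟩, ?_⟩
  · intro f q
    funext i
    exact (lift (hA i) (a i)).map_op f q
  · intro p q hpq
    by_contra hne
    have hn : ¬ (idc V X).rel (rep p) (rep q) := by
      intro h
      apply hne
      rw [← rep_eval p, ← rep_eval q, gen_eval, gen_eval]
      exact Quotient.sound (s := (idc V X).setoid) h
    exact ha ⟨(rep p, rep q), hn⟩ (congrFun hpq ⟨(rep p, rep q), hn⟩)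

/-! ### two generators -/

theorem ev_vec2 {A : Alg σ} {X : Type} (a : X → A.carrier) (s t : Trm σ X) (d : Trm σ (Fin 2)) :
    A.evalTrm a (tsub ![s, t] d) = A.evalTrm ![A.evalTrm a s, A.evalTrm a t] d := by
  rw [eval_tsub]
  congr 1
  funext i
  fin_cases i <;> rfl

theorem ev_vec3 {A : Alg σ} {X : Type} (a : X → A.carrier) (s t u : Trm σ X)
    (d : Trm σ (Fin 3)) :
    A.evalTrm a (tsub ![s, t, u] d)
      = A.evalTrm ![A.evalTrm a s, A.evalTrm a t, A.evalTrm a u] d := by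
  rw [eval_tsub]
  congr 1
  funext i
  fin_cases i <;> rfl

/-- free algebra on two generators -/
noncomputable abbrev F2 (V : Variety σ) : Alg σ := Free V (Fin 2)

/-- first generator -/
noncomputable def gx (V : Variety σ) : (F2 V).carrier := gen V 0
/-- second generator -/
noncomputable def gz (V : Variety σ) : (F2 V).carrier := gen V 1

theorem gen2 (V : Variety σ) : (gen V : Fin 2 → (F2 V).carrier) = ![gx V, gz V] := by
  funext i
  fin_cases i <;> rfl

theorem rep2 {V : Variety σ} (c : (F2 V).carrier) :
    (F2 V).evalTrm ![gx V, gz V] (rep c) = c := by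
  rw [← gen2]
  exact rep_eval c

theorem id2 {V : Variety σ} {s t : Trm σ (Fin 2)}
    (h : (F2 V).evalTrm ![gx V, gz V] s = (F2 V).evalTrm ![gx V, gz V] t)
    {A : Alg σ} (hA : V.Mem A) (a b : A.carrier) :
    A.evalTrm ![a, b] s = A.evalTrm ![a, b] t := by
  rw [← gen2] at h
  exact free_id h hA _

/-- the principal congruence identifying the generators -/
noncomputable def th (V : Variety σ) : Congruence (F2 V) :=
  cg (F2 V) (fun a b => a = gx V ∧ b = gz V)

/-- its commutator -/
noncomputable def nn (V : Variety σ) : Congruence (F2 V) := commC (th V) (th V)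

theorem th_xz (V : Variety σ) : (th V).rel (gx V) (gz V) := cg_of ⟨rfl, rfl⟩

theorem nn_cent (V : Variety σ) : Centralizes (th V) (th V) (nn V) := cent_comm _ _

theorem nn_le (V : Variety σ) : nn V ≤ th V :=
  (comm_le (cent_meet _ _)).trans inf_le_left

theorem th_univ {V : Variety σ} {A : Alg σ} (hA : V.Mem A) {μ : Congruence A} {a b : A.carrier}
    (h : μ.rel a b) : th V ≤ pull (lift (V := V) hA ![a, b]) μ := by
  apply cg_le
  rintro _ _ ⟨rfl, rfl⟩
  have e0 : (lift (V := V) hA ![a, b]).toFun (gx V) = a :=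
    lift_eval hA ![a, b] (.var 0)
  have e1 : (lift (V := V) hA ![a, b]).toFun (gz V) = b :=
    lift_eval hA ![a, b] (.var 1)
  show μ.rel _ _
  rw [e0, e1]
  exact h

theorem lift2 {V : Variety σ} {A : Alg σ} (hA : V.Mem A) (a b : A.carrier) (t : Trm σ (Fin 2)) :
    (lift (V := V) hA ![a, b]).toFun ((F2 V).evalTrm ![gx V, gz V] t) = A.evalTrm ![a, b] t := by
  rw [← gen2]
  exact lift_eval hA _ t

/-- `N`-identities -/
theorem nn_univ {V : Variety σ} {A : Alg σ} (hA : V.Mem A) {μ δ : Congruence A}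
    (hc : Centralizes μ μ δ) {a b : A.carrier} (h : μ.rel a b) {s t : Trm σ (Fin 2)}
    (hst : (nn V).rel ((F2 V).evalTrm ![gx V, gz V] s) ((F2 V).evalTrm ![gx V, gz V] t)) :
    δ.rel (A.evalTrm ![a, b] s) (A.evalTrm ![a, b] t) := by
  have h1 : nn V ≤ pull (lift (V := V) hA ![a, b]) δ :=
    comm_le (cent_mono (cent_pull _ hc) (th_univ hA h) (th_univ hA h))
  have := h1 _ _ hst
  simp only [pull, lift2] at this
  exact this

theorem th_diag {V : Variety σ} {A : Alg σ} (hA : V.Mem A) (a : A.carrier) {s t : Trm σ (Fin 2)}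
    (hst : (th V).rel ((F2 V).evalTrm ![gx V, gz V] s) ((F2 V).evalTrm ![gx V, gz V] t)) :
    A.evalTrm ![a, a] s = A.evalTrm ![a, a] t := by
  let μ : Congruence A := ⟨Eq, ⟨fun _ => rfl, Eq.symm, Eq.trans⟩,
    fun f a b h => congrArg _ (funext h)⟩
  have := (th_univ (V := V) (μ := μ) hA (a := a) (b := a) rfl) _ _ hst
  simp only [pull, lift2] at this
  exact this

end DC

namespace DC

variable {σ : Sig}

/-- ternary term evaluation -/
def e3 (A : Alg σ) (d : Trm σ (Fin 3)) (a b c : A.carrier) : A.carrier := A.evalTrm ![a, b, c] d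

/-- variables -/
def v0 : Trm σ (Fin 3) := .var 0
/-- variables -/
def v1 : Trm σ (Fin 3) := .var 1
/-- variables -/
def v2 : Trm σ (Fin 3) := .var 2

@[simp] theorem e3_v0 (A : Alg σ) (a b c : A.carrier) : e3 A v0 a b c = a := rfl
@[simp] theorem e3_v1 (A : Alg σ) (a b c : A.carrier) : e3 A v1 a b c = b := rfl
@[simp] theorem e3_v2 (A : Alg σ) (a b c : A.carrier) : e3 A v2 a b c = c := rfl

/-- composition -/
def cp (d s t u : Trm σ (Fin 3)) : Trm σ (Fin 3) := tsub ![s, t, u] d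

@[simp] theorem e3_cp (A : Alg σ) (d s t u : Trm σ (Fin 3)) (a b c : A.carrier) :
    e3 A (cp d s t u) a b c = e3 A d (e3 A s a b c) (e3 A t a b c) (e3 A u a b c) :=
  ev_vec3 _ _ _ _ _

theorem e3_rel {A : Alg σ} (δ : Congruence A) (d : Trm σ (Fin 3)) {a b c a' b' c' : A.carrier}
    (ha : δ.rel a a') (hb : δ.rel b b') (hc : δ.rel c c') :
    δ.rel (e3 A d a b c) (e3 A d a' b' c') := by
  apply rel_eval
  intro i
  fin_cases i
  · exact ha
  · exact hb
  · exact hc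

theorem rr {A : Alg σ} (δ : Congruence A) (a : A.carrier) : δ.rel a a := δ.iseqv.refl a

/-- `N`-identity `d(x,x,z) = z` -/
theorem wd_N {V : Variety σ} {d : Trm σ (Fin 3)}
    (h : (nn V).rel (e3 (F2 V) d (gx V) (gx V) (gz V)) (gz V)) {A : Alg σ} (hA : V.Mem A)
    {μ δ : Congruence A} (hc : Centralizes μ μ δ) {a b : A.carrier} (hab : μ.rel a b) :
    δ.rel (e3 A d a a b) b := by
  have k := nn_univ hA hc hab (s := tsub ![.var 0, .var 0, .var 1] d) (t := .var 1)
    (by rw [ev_vec3]; exact h)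
  rw [ev_vec3] at k
  exact k

theorem wd_N2 {V : Variety σ} {d : Trm σ (Fin 3)}
    (h : (nn V).rel (e3 (F2 V) d (gx V) (gz V) (gz V)) (gx V)) {A : Alg σ} (hA : V.Mem A)
    {μ δ : Congruence A} (hc : Centralizes μ μ δ) {a b : A.carrier} (hab : μ.rel a b) :
    δ.rel (e3 A d a b b) a := by
  have k := nn_univ hA hc hab (s := tsub ![.var 0, .var 1, .var 1] d) (t := .var 0)
    (by rw [ev_vec3]; exact h)
  rw [ev_vec3] at k
  exact k

theorem wd_idem {V : Variety σ} {d : Trm σ (Fin 3)}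
    (h : (nn V).rel (e3 (F2 V) d (gx V) (gx V) (gz V)) (gz V)) {A : Alg σ} (hA : V.Mem A)
    (a : A.carrier) : e3 A d a a a = a := by
  have k := th_diag (V := V) hA a (s := tsub ![.var 0, .var 0, .var 1] d) (t := .var 1)
    (by rw [ev_vec3]; exact nn_le V _ _ h)
  rw [ev_vec3] at k
  exact k

/-- centralizer for terms in three variables, first is a row variable, others columns -/
theorem cent_e3 {A : Alg σ} {S T δ : Congruence A} (h : Centralizes S T δ) (f : Trm σ (Fin 3))
    {s s' b b' c c' : A.carrier} (hs : S.rel s s') (hb : T.rel b b') (hc : T.rel c c')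
    (h0 : δ.rel (e3 A f s b c) (e3 A f s b' c')) : δ.rel (e3 A f s' b c) (e3 A f s' b' c') := by
  refine cent4 h f ![s, b, c] ![s, b', c'] ![s', b, c] ![s', b', c'] ?_ h0
  intro w
  fin_cases w
  · exact Or.inl ⟨rfl, rfl, hs⟩
  · exact Or.inr ⟨rfl, rfl, hb⟩
  · exact Or.inr ⟨rfl, rfl, hc⟩

theorem inv_lem {V : Variety σ} {d : Trm σ (Fin 3)}
    (h : (nn V).rel (e3 (F2 V) d (gx V) (gx V) (gz V)) (gz V)) {a v u : (F2 V).carrier}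
    (hav : (th V).rel a v) (hau : (th V).rel a u) :
    (nn V).rel (e3 (F2 V) d v a (e3 (F2 V) d a v u)) u := by
  have hF := free_mem V (Fin 2)
  have hN := nn_cent V
  have hva := (th V).iseqv.symm hav
  have hvu := (th V).iseqv.trans hva hau
  have e : ∀ s m1 m2 m3 : (F2 V).carrier,
      (F2 V).evalTrm ![s, m1, m2, m3, u] (tsub ![.var 0, .var 1,
        tsub ![.var 2, .var 3, .var 4] d] d) = e3 (F2 V) d s m1 (e3 (F2 V) d m2 m3 u) := by
    intro s m1 m2 m3
    rw [ev_vec3, ev_vec3]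
    rfl
  have key := cent4 hN (tsub ![.var 0, .var 1, tsub ![.var 2, .var 3, .var 4] d] d)
    ![a, a, a, v, u] ![a, v, a, a, u] ![v, a, a, v, u] ![v, v, a, a, u]
    (by
      intro w
      fin_cases w
      · exact Or.inl ⟨rfl, rfl, hav⟩
      · exact Or.inr ⟨rfl, rfl, hav⟩
      · exact Or.inr ⟨rfl, rfl, rr _ _⟩
      · exact Or.inr ⟨rfl, rfl, hva⟩
      · exact Or.inr ⟨rfl, rfl, rr _ _⟩)
  rw [e, e, e, e] at key
  have h1 : (th V).rel a (e3 (F2 V) d a v u) := by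
    have := e3_rel (th V) d (rr _ a) hav hau
    rwa [wd_idem h hF] at this
  have k1 := wd_N h hF hN h1
  have k2 := wd_N h hF hN hau
  have k3 := key ((nn V).iseqv.trans k1 ((nn V).iseqv.symm (e3_rel (nn V) d (rr _ _) (rr _ _) k2)))
  refine (nn V).iseqv.trans k3 ((nn V).iseqv.trans (e3_rel (nn V) d (rr _ _) (rr _ _) k2) ?_)
  exact wd_N h hF hN hvu

theorem poly_term {V : Variety σ} (t : Trm σ (Option (F2 V).carrier)) :
    ∃ g : Trm σ (Fin 3), ∀ v, pev (F2 V) v t = e3 (F2 V) g v (gx V) (gz V) := by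
  refine ⟨tsub (fun o => o.elim (.var 0) (fun c => tsub ![.var 1, .var 2] (rep c))) t, ?_⟩
  intro v
  unfold e3 pev
  rw [eval_tsub]
  congr 1
  funext o
  cases o with
  | none => rfl
  | some c =>
    simp only [Option.elim]
    rw [ev_vec2]
    exact (rep2 c).symm

/-- Taylor data, normalized -/
structure TData (V : Variety σ) where
  n : ℕ
  T : Trm σ (Fin n)
  w : Fin n → Fin n → Bool
  z : Fin n → Fin n → Bool
  idem : ∀ A : Alg σ, V.Mem A → ∀ c : A.carrier, A.evalTrm (fun _ => c) T = c
  wi : ∀ i, w i i = true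
  zi : ∀ i, z i i = false
  ident : ∀ i, ∀ A : Alg σ, V.Mem A → ∀ x y : A.carrier,
      A.evalTrm (fun j => cond (w i j) x y) T = A.evalTrm (fun j => cond (z i j) x y) T

theorem exists_tdata {V : Variety σ} (h : HasTaylorTrm V) : Nonempty (TData V) := by
  obtain ⟨n, T, -, h1, h2⟩ := h
  have : ∀ i : Fin n, ∃ w z : Fin n → Bool, w i = true ∧ z i = false ∧
    ∀ A : Alg σ, V.Mem A → ∀ x y : A.carrier,
      A.evalTrm (fun j => cond (w j) x y) T = A.evalTrm (fun j => cond (z j) x y) T := by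
    intro i
    obtain ⟨w, z, hne, hid⟩ := h2 i
    cases hw : w i with
    | true =>
      refine ⟨w, z, hw, ?_, hid⟩
      cases hz : z i with
      | true => exact absurd (hw.trans hz.symm) hne
      | false => rfl
    | false =>
      refine ⟨z, w, ?_, hw, fun A hA x y => (hid A hA x y).symm⟩
      cases hz : z i with
      | true => rfl
      | false => exact absurd (hw.trans hz.symm) hne
  choose w z a b c using this
  exact ⟨⟨n, T, w, z, h1, a, b, c⟩⟩

/-- value of the Taylor term with the `i`-th place separated -/
def TData.tv {V : Variety σ} (D : TData V) (A : Alg σ) (i : Fin D.n) (r : Fin D.n → Bool)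
    (s a b : A.carrier) : A.carrier :=
  A.evalTrm (fun j => if j = i then s else cond (r j) a b) D.T

/-- the corresponding term -/
def TData.pt {V : Variety σ} (D : TData V) (i : Fin D.n) (r : Fin D.n → Bool)
    (s a b : Trm σ (Fin 3)) : Trm σ (Fin 3) :=
  tsub (fun j => if j = i then s else cond (r j) a b) D.T

@[simp] theorem TData.e3_pt {V : Variety σ} (D : TData V) (A : Alg σ) (i : Fin D.n)
    (r : Fin D.n → Bool) (s t u : Trm σ (Fin 3)) (a b c : A.carrier) :
    e3 A (D.pt i r s t u) a b c = D.tv A i r (e3 A s a b c) (e3 A t a b c) (e3 A u a b c) := by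
  unfold e3 TData.pt TData.tv
  rw [eval_tsub]
  congr 1
  funext j
  split_ifs
  · rfl
  · cases r j <;> rfl

theorem TData.tv_zzz {V : Variety σ} (D : TData V) {A : Alg σ} (hA : V.Mem A) (i : Fin D.n)
    (r : Fin D.n → Bool) (a : A.carrier) : D.tv A i r a a a = a := by
  unfold TData.tv
  convert D.idem A hA a using 2
  funext j
  split_ifs
  · rfl
  · cases r j <;> rfl

theorem TData.tv_id {V : Variety σ} (D : TData V) {A : Alg σ} (hA : V.Mem A) (i : Fin D.n)
    (a b : A.carrier) : D.tv A i (D.w i) a a b = D.tv A i (D.z i) b a b := by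
  unfold TData.tv
  have := D.ident i A hA a b
  convert this using 2
  · funext j
    split_ifs with h
    · subst h; rw [D.wi]; rfl
    · rfl
  · funext j
    split_ifs with h
    · subst h; rw [D.zi]; rfl
    · rfl

theorem TData.tv_rel {V : Variety σ} (D : TData V) {A : Alg σ} (δ : Congruence A) (i : Fin D.n)
    (r : Fin D.n → Bool) {s a b s' a' b' : A.carrier} (hs : δ.rel s s') (ha : δ.rel a a')
    (hb : δ.rel b b') : δ.rel (D.tv A i r s a b) (D.tv A i r s' a' b') := by
  apply rel_eval
  intro j
  split_ifs
  · exact hs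
  · cases r j
    · exact hb
    · exact ha

/-- the congruence making the Taylor term independent of its places -/
def TData.kap {V : Variety σ} (D : TData V) (A : Alg σ) (a b : A.carrier) : Congruence A :=
  cg A (fun p q => ∃ i, p = D.tv A i (D.z i) b a b ∧ q = D.tv A i (D.z i) a a b)

/-- the predicate of step C -/
def Kw (V : Variety σ) (c : (F2 V).carrier) : Prop :=
  ∃ d : Trm σ (Fin 3), (nn V).rel (e3 (F2 V) d (gx V) (gx V) (gz V)) (gz V) ∧
    (nn V).rel (e3 (F2 V) d (gx V) (gz V) (gz V)) c

theorem kap_step {V : Variety σ} (D : TData V) (i : Fin D.n) (t : Trm σ (Option (F2 V).carrier)) :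
    Kw V (pev (F2 V) (D.tv (F2 V) i (D.z i) (gz V) (gx V) (gz V)) t) ↔
    Kw V (pev (F2 V) (D.tv (F2 V) i (D.z i) (gx V) (gx V) (gz V)) t) := by
  obtain ⟨g, hg⟩ := poly_term t
  rw [hg, hg]
  have hF := free_mem V (Fin 2)
  have hN := nn_cent V
  have hxz := th_xz V
  have hzx := (th V).iseqv.symm hxz
  -- common facts
  have common : ∀ (d : Trm σ (Fin 3)) (c : (F2 V).carrier),
      (nn V).rel (e3 (F2 V) d (gx V) (gx V) (gz V)) (gz V) →
      (nn V).rel (e3 (F2 V) d (gx V) (gz V) (gz V)) c →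
      (th V).rel c (gz V) ∧ (nn V).rel (e3 (F2 V) d (gz V) (gx V) c) (gz V) := by
    intro d c h1 h2
    constructor
    · have k := e3_rel (th V) d hxz (rr _ (gz V)) (rr _ (gz V))
      rw [wd_idem h1 hF] at k
      exact (th V).iseqv.trans ((th V).iseqv.symm (nn_le V _ _ h2)) k
    · have k := inv_lem h1 (a := gx V) (v := gz V) (u := gz V) hxz hxz
      exact (nn V).iseqv.trans (e3_rel (nn V) d (rr _ _) (rr _ _) ((nn V).iseqv.symm h2)) k
  have hcc : (th V).rel
      (e3 (F2 V) g (D.tv (F2 V) i (D.z i) (gz V) (gx V) (gz V)) (gx V) (gz V))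
      (e3 (F2 V) g (D.tv (F2 V) i (D.z i) (gx V) (gx V) (gz V)) (gx V) (gz V)) :=
    e3_rel _ g (D.tv_rel _ i _ hzx (rr _ _) (rr _ _)) (rr _ _) (rr _ _)
  constructor
  · -- case 2
    rintro ⟨d, h1, h2⟩
    obtain ⟨c1, c2⟩ := common d _ h1 h2
    have c3 := (th V).iseqv.trans ((th V).iseqv.symm hcc) c1
    refine ⟨cp d v0 v1 (cp d v2 v1 (cp g (D.pt i (D.w i) v0 v1 v2) v1 v2)), ?_, ?_⟩
    · simp only [e3_cp, e3_v0, e3_v1, e3_v2, D.e3_pt]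
      rw [D.tv_id hF]
      exact (nn V).iseqv.trans (e3_rel (nn V) d (rr _ _) (rr _ _) c2) h1
    · simp only [e3_cp, e3_v0, e3_v1, e3_v2, D.e3_pt]
      have gz1 : e3 (F2 V) g (gz V) (gz V) (gz V) = gz V := by
        have k : (th V).rel (e3 (F2 V) g (gz V) (gz V) (gz V)) (gz V) := by
          refine (th V).iseqv.trans ?_ c1
          apply e3_rel
          · have := D.tv_rel (th V) i (D.z i) (rr _ (gz V)) hzx (rr _ (gz V))
            rwa [D.tv_zzz hF] at this
          · exact hzx
          · exact rr _ _
        have k2 := th_diag (V := V) hF (gz V) (s := tsub ![.var 1, .var 1, .var 1] g) (t := .var 1)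
          (by rw [ev_vec3]; exact k)
        rw [ev_vec3] at k2
        exact k2
      have key := cent_e3 hN (cp d v2 v1 (cp g (D.pt i (D.z i) v0 v1 v2) v1 v2))
        (s := gz V) (s' := gx V) (b := gz V) (b' := gx V) (c := gz V) (c' := gz V)
        hzx hzx (rr _ _)
      simp only [e3_cp, e3_v0, e3_v1, e3_v2, D.e3_pt] at key
      rw [D.tv_zzz hF, gz1, wd_idem h1 hF] at key
      have key := key ((nn V).iseqv.symm c2)
      have ez : ∀ r r' : Fin D.n → Bool, D.tv (F2 V) i r (gx V) (gz V) (gz V)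
          = D.tv (F2 V) i r' (gx V) (gz V) (gz V) := by
        intro r r'
        unfold TData.tv
        congr 1
        funext j
        split_ifs
        · rfl
        · cases r j <;> cases r' j <;> rfl
      rw [ez (D.w i) (D.z i)]
      refine (nn V).iseqv.trans (e3_rel (nn V) d (rr _ _) (rr _ _) key) ?_
      exact inv_lem h1 hzx ((th V).iseqv.symm c3)
  · -- case 1
    rintro ⟨d, h1, h2⟩
    obtain ⟨c1, c2⟩ := common d _ h1 h2
    have c3 := (th V).iseqv.trans hcc c1
    refine ⟨cp d v0 v1 (cp d v2 v0 (cp g (D.pt i (D.z i) v1 v0 v2) v0 v2)), ?_, ?_⟩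
    · simp only [e3_cp, e3_v0, e3_v1, e3_v2, D.e3_pt]
      exact (nn V).iseqv.trans (e3_rel (nn V) d (rr _ _) (rr _ _) c2) h1
    · simp only [e3_cp, e3_v0, e3_v1, e3_v2, D.e3_pt]
      exact inv_lem h1 hzx ((th V).iseqv.symm c3)

theorem Kw_of_omega {V : Variety σ} (D : TData V)
    (h : (D.kap (F2 V) (gx V) (gz V) ⊔ nn V).rel (gz V) (gx V)) : Kw V (gx V) := by
  refine sup_sat (P := Kw V) ?_ ?_ h ?_
  · intro a b hab
    refine cg_sat ?_ hab
    rintro p q ⟨i, rfl, rfl⟩ t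
    exact kap_step D i t
  · rintro a b hab ⟨d, h1, h2⟩
    exact ⟨d, h1, (nn V).iseqv.trans h2 hab⟩
  · exact ⟨v2, rr _ _, rr _ _⟩

end DC

namespace DC

variable {σ : Sig}

theorem TData.hom_tv {V : Variety σ} (D : TData V) {A B : Alg σ} (f : UAHom A B) (i : Fin D.n)
    (r : Fin D.n → Bool) (s a b : A.carrier) :
    f.toFun (D.tv A i r s a b) = D.tv B i r (f.toFun s) (f.toFun a) (f.toFun b) := by
  unfold TData.tv
  rw [hom_eval]
  congr 1
  funext j
  split_ifs
  · rfl
  · cases r j <;> rfl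

theorem TData.kap_pull {V : Variety σ} (D : TData V) {A B : Alg σ} (f : UAHom A B)
    (a b : A.carrier) : D.kap A a b ≤ pull f (D.kap B (f.toFun a) (f.toFun b)) := by
  apply cg_le
  rintro _ _ ⟨i, rfl, rfl⟩
  refine cg_of ⟨i, D.hom_tv f _ _ _ _ _, D.hom_tv f _ _ _ _ _⟩

theorem TData.kap_all {V : Variety σ} (D : TData V) {A : Alg σ} (hA : V.Mem A)
    {γ Q : Congruence A} (hQ : Centralizes γ γ Q) {a b : A.carrier} (hab : γ.rel a b)
    (hk : D.kap A a b ≤ Q) : Q.rel a b := by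
  classical
  have hba := γ.iseqv.symm hab
  have hcond : ∀ p q : Bool, γ.rel (cond p a b) (cond q a b) := by
    intro p q
    cases p <;> cases q <;> first | exact rr _ _ | exact hab | exact hba
  have one : ∀ (i : Fin D.n) (r : Fin D.n → Bool),
      Q.rel (D.tv A i r b a b) (D.tv A i r a a b) := by
    intro i r
    have h0 : Q.rel (D.tv A i (D.z i) b a b) (D.tv A i (D.z i) a a b) :=
      hk _ _ (cg_of ⟨i, rfl, rfl⟩)
    refine cent4 hQ D.T _ _ _ _ ?_ h0
    intro j
    by_cases h : j = i
    · right
      simp only [h, if_true]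
      exact ⟨trivial, trivial, hba⟩
    · left
      simp only [h, if_false]
      exact ⟨trivial, trivial, hcond _ _⟩
  have all : ∀ s : Finset (Fin D.n),
      Q.rel a (A.evalTrm (fun j => cond (decide (j ∉ s)) a b) D.T) := by
    intro s
    induction s using Finset.induction_on with
    | empty =>
      simp only [Finset.notMem_empty, not_false_eq_true, decide_true, cond_true]
      rw [D.idem A hA]
      exact rr _ _
    | insert i s hi ih =>
      refine Q.iseqv.trans ih (Q.iseqv.symm ?_)
      have := one i (fun j => decide (j ∉ s))
      unfold TData.tv at this
      convert this using 3
      · rename_i j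
        by_cases h : j = i
        · simp [h]
        · simp [h]
      · rename_i j
        by_cases h : j = i
        · simp [h, hi]
        · simp [h]
  have := all Finset.univ
  simp only [Finset.mem_univ, not_true_eq_false, decide_false, cond_false] at this
  rwa [D.idem A hA] at this

theorem TData.kap_le {V : Variety σ} (D : TData V) {A : Alg σ}
    {γ : Congruence A} {a b : A.carrier} (hab : γ.rel a b) : D.kap A a b ≤ γ := by
  apply cg_le
  rintro _ _ ⟨i, rfl, rfl⟩
  exact D.tv_rel γ i _ (γ.iseqv.symm hab) (rr _ _) (rr _ _)

/-- the equality congruence -/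
def eqc (A : Alg σ) : Congruence A := ⟨Eq, ⟨fun _ => rfl, Eq.symm, Eq.trans⟩,
    fun _ _ _ h => congrArg _ (funext h)⟩

theorem omega_xz {V : Variety σ} (hD : CommLeftDistrib V ∨ CommRightDistrib V) (D : TData V) :
    (D.kap (F2 V) (gx V) (gz V) ⊔ nn V).rel (gx V) (gz V) := by
  have hF := free_mem V (Fin 2)
  have hG := free_mem V (Fin 3)
  set X : (Free V (Fin 3)).carrier := gen V 0 with hX
  set Y : (Free V (Fin 3)).carrier := gen V 1 with hY
  set Z : (Free V (Fin 3)).carrier := gen V 2 with hZ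
  have lX : ∀ a b c : (F2 V).carrier, (lift (V := V) hF ![a, b, c]).toFun X = a :=
    fun a b c => lift_eval hF ![a, b, c] (.var 0)
  have lY : ∀ a b c : (F2 V).carrier, (lift (V := V) hF ![a, b, c]).toFun Y = b :=
    fun a b c => lift_eval hF ![a, b, c] (.var 1)
  have lZ : ∀ a b c : (F2 V).carrier, (lift (V := V) hF ![a, b, c]).toFun Z = c :=
    fun a b c => lift_eval hF ![a, b, c] (.var 2)
  have le3 : ∀ (a b c : (F2 V).carrier) (g : (Free V (Fin 3)).carrier),
      (lift (V := V) hF ![a, b, c]).toFun g = e3 (F2 V) (rep g) a b c := fun a b c g => rfl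
  let α := cg (Free V (Fin 3)) (fun a b => a = X ∧ b = Y)
  let β := cg (Free V (Fin 3)) (fun a b => a = Y ∧ b = Z)
  let γ := cg (Free V (Fin 3)) (fun a b => a = X ∧ b = Z)
  let κ := D.kap (Free V (Fin 3)) X Z
  have gXZ : γ.rel X Z := cg_of ⟨rfl, rfl⟩
  have kg : κ ≤ γ := D.kap_le gXZ
  have gab : γ ≤ (α ⊔ κ) ⊔ (β ⊔ κ) := by
    apply cg_le
    rintro _ _ ⟨rfl, rfl⟩
    refine Congruence.iseqv _ |>.trans (y := Y) ?_ ?_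
    · exact sup_l _ _ (sup_l _ _ (cg_of ⟨rfl, rfl⟩))
    · exact sup_r _ _ (sup_l _ _ (cg_of ⟨rfl, rfl⟩))
  obtain ⟨Q, q1, q2, q3⟩ := stepA_star hD hG κ γ (α ⊔ κ) (β ⊔ κ) kg le_sup_right le_sup_right gab
  have hQ : Q.rel X Z := D.kap_all hG q3 gXZ q1
  have hQ := q2 _ _ hQ
  set Ω := D.kap (F2 V) (gx V) (gz V) ⊔ nn V with hΩ
  have sO : (α ⊔ κ) ≤ pull (lift (V := V) hF ![gx V, gx V, gz V]) Ω := by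
    apply sup_le
    · apply cg_le
      rintro _ _ ⟨rfl, rfl⟩
      show Ω.rel _ _
      rw [lX, lY]
      exact rr _ _
    · intro a b hab
      have := D.kap_pull (lift (V := V) hF ![gx V, gx V, gz V]) X Z a b hab
      rw [lX, lZ] at this
      exact sup_l _ _ this
  have tO : (β ⊔ κ) ≤ pull (lift (V := V) hF ![gx V, gz V, gz V]) Ω := by
    apply sup_le
    · apply cg_le
      rintro _ _ ⟨rfl, rfl⟩
      show Ω.rel _ _
      rw [lY, lZ]
      exact rr _ _
    · intro a b hab
      have := D.kap_pull (lift (V := V) hF ![gx V, gz V, gz V]) X Z a b hab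
      rw [lX, lZ] at this
      exact sup_l _ _ this
  have gO : ∀ a b : (F2 V).carrier, γ ≤ pull (lift (V := V) hF ![a, b, a]) (eqc _) := by
    intro a b
    apply cg_le
    rintro _ _ ⟨rfl, rfl⟩
    show _ = _
    rw [lX, lZ]
  have hN := nn_cent V
  have hxz := th_xz V
  have mid : ∀ g, γ.rel X g → (nn V).rel
      ((lift (V := V) hF ![gx V, gz V, gz V]).toFun g)
      ((lift (V := V) hF ![gx V, gx V, gz V]).toFun g) := by
    intro g hg
    have a1 : (lift (V := V) hF ![gx V, gz V, gx V]).toFun X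
      = (lift (V := V) hF ![gx V, gz V, gx V]).toFun g := gO (gx V) (gz V) _ _ hg
    have a2 : (lift (V := V) hF ![gx V, gx V, gx V]).toFun X
      = (lift (V := V) hF ![gx V, gx V, gx V]).toFun g := gO (gx V) (gx V) _ _ hg
    rw [lX, le3] at a1 a2
    rw [le3, le3]
    refine cent4 hN (rep g) ![gx V, gz V, gx V] ![gx V, gx V, gx V] ![gx V, gz V, gz V]
      ![gx V, gx V, gz V] ?_ ?_
    · intro w
      fin_cases w
      · exact Or.inl ⟨rfl, rfl, rr _ _⟩
      · exact Or.inr ⟨rfl, rfl, (th V).iseqv.symm hxz⟩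
      · exact Or.inl ⟨rfl, rfl, hxz⟩
    · show (nn V).rel (e3 _ _ _ _ _) (e3 _ _ _ _ _)
      rw [← a1, ← a2]
      exact rr _ _
  have fin := sup_sat (P := fun g => γ.rel X g ∧
      Ω.rel (gx V) ((lift (V := V) hF ![gx V, gx V, gz V]).toFun g)) ?_ ?_ hQ ?_
  · rw [lZ] at fin
    exact fin.2
  · rintro a b hab ⟨h1, h2⟩
    rw [inf_rel] at hab
    exact ⟨γ.iseqv.trans h1 hab.2, Ω.iseqv.trans h2 (sO _ _ hab.1)⟩
  · rintro a b hab ⟨h1, h2⟩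
    rw [inf_rel] at hab
    have h3 := γ.iseqv.trans h1 hab.2
    refine ⟨h3, ?_⟩
    refine Ω.iseqv.trans h2 (Ω.iseqv.trans (Ω.iseqv.symm (sup_r _ _ (mid a h1))) ?_)
    exact Ω.iseqv.trans (tO _ _ hab.1) (sup_r _ _ (mid b h3))
  · refine ⟨rr _ _, ?_⟩
    rw [lX]
    exact rr _ _

theorem exists_wd {V : Variety σ} (hD : CommLeftDistrib V ∨ CommRightDistrib V)
    (hT : HasTaylorTrm V) : Kw V (gx V) := by
  obtain ⟨D⟩ := exists_tdata hT
  exact Kw_of_omega D (Congruence.iseqv _ |>.symm (omega_xz hD D))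

end DC

namespace DC

variable {σ : Sig}

theorem e3_hom {A B : Alg σ} (h : UAHom A B) (d : Trm σ (Fin 3)) (a b c : A.carrier) :
    h.toFun (e3 A d a b c) = e3 B d (h.toFun a) (h.toFun b) (h.toFun c) := by
  unfold e3
  rw [hom_eval]
  congr 1
  funext i
  fin_cases i <;> rfl

/-- projection -/
def pr1 (A : Alg σ) (α : Congruence A) : UAHom (algOn A α) A := ⟨fun p => p.1.1, fun _ _ => rfl⟩
/-- projection -/
def pr2 (A : Alg σ) (α : Congruence A) : UAHom (algOn A α) A := ⟨fun p => p.1.2, fun _ _ => rfl⟩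

/-- generating pairs of `δ*` -/
def dsR (V : Variety σ) (d : Trm σ (Fin 3)) (a b : (algOn (F2 V) (th V)).carrier) : Prop :=
  a.1.2 = b.1.2 ∧ ((nn V).rel a.1.1 b.1.1 ∨ a.1.2 = e3 (F2 V) d (gx V) (gx V) (gz V))

/-- the congruence `δ*` -/
noncomputable def ds (V : Variety σ) (d : Trm σ (Fin 3)) : Congruence (algOn (F2 V) (th V)) :=
  cg _ (dsR V d)

theorem ds_le (V : Variety σ) (d : Trm σ (Fin 3)) : ds V d ≤ eta2 (F2 V) (th V) :=
  cg_le fun _ _ h => h.1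

/-- the predicate of step D -/
def Kd (V : Variety σ) (c : (F2 V).carrier) : Prop :=
  ∃ e : Trm σ (Fin 3), e3 (F2 V) e (gx V) (gx V) (gz V) = gz V ∧
    (nn V).rel (e3 (F2 V) e (gx V) (gz V) (gz V)) c

theorem ds_step {V : Variety σ} {d : Trm σ (Fin 3)}
    (h1 : (nn V).rel (e3 (F2 V) d (gx V) (gx V) (gz V)) (gz V))
    (h2 : (nn V).rel (e3 (F2 V) d (gx V) (gz V) (gz V)) (gx V))
    (a b : (algOn (F2 V) (th V)).carrier) (hab : dsR V d a b)
    (t : Trm σ (Option (algOn (F2 V) (th V)).carrier))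
    (hz : (pev _ b t).1.2 = gz V)
    (hP : (pev _ a t).1.2 = gz V → Kd V (pev _ a t).1.1) : Kd V (pev _ b t).1.1 := by
  have hF := free_mem V (Fin 2)
  have hN := nn_cent V
  have hxz := th_xz V
  have hzx := (th V).iseqv.symm hxz
  have p1 : ∀ c : (algOn (F2 V) (th V)).carrier, (pev _ c t).1.1
      = (F2 V).evalTrm (fun o : Option (algOn (F2 V) (th V)).carrier =>
        o.elim c.1.1 (fun q => q.1.1)) t := by
    intro c
    have := hom_eval (pr1 (F2 V) (th V)) (fun o : Option (algOn (F2 V) (th V)).carrier =>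
      o.elim c id) t
    refine this.trans ?_
    congr 1
    funext o
    cases o <;> rfl
  have p2 : ∀ c : (algOn (F2 V) (th V)).carrier, (pev _ c t).1.2
      = (F2 V).evalTrm (fun o : Option (algOn (F2 V) (th V)).carrier =>
        o.elim c.1.2 (fun q => q.1.2)) t := by
    intro c
    have := hom_eval (pr2 (F2 V) (th V)) (fun o : Option (algOn (F2 V) (th V)).carrier =>
      o.elim c id) t
    refine this.trans ?_
    congr 1
    funext o
    cases o <;> rfl
  rw [p2] at hz hP
  rw [p1] at hP ⊢
  obtain ⟨e12, hor⟩ := hab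
  rw [e12] at hP
  obtain ⟨e, he1, he2⟩ := hP hz
  rcases hor with hor | hor
  · refine ⟨e, he1, (nn V).iseqv.trans he2 ?_⟩
    apply rel_eval
    intro o
    cases o with
    | none => exact hor
    | some q => exact rr _ _
  · rw [e12] at hor
    set z' := e3 (F2 V) d (gx V) (gx V) (gz V) with hz'
    have hz'z : (th V).rel z' (gz V) := nn_le V _ _ h1
    set u := a.1.1 with hu
    set v := b.1.1 with hv
    have huz : (th V).rel u (gz V) := by
      have := a.2
      rw [e12, hor] at this
      exact (th V).iseqv.trans this hz'z
    have hvz : (th V).rel v (gz V) := by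
      have := b.2
      rw [hor] at this
      exact (th V).iseqv.trans this hz'z
    have diag : ∀ c : (F2 V).carrier, (th V).rel c (gz V) →
        (F2 V).evalTrm ![gx V, gx V] (rep c) = gx V := by
      intro c hc
      exact th_diag (V := V) hF (gx V) (s := rep c) (t := .var 1) (by rw [rep2]; exact hc)
    set cc := e3 (F2 V) e (gx V) (gz V) (gz V) with hcc
    have hcz : (th V).rel cc (gz V) := by
      have := e3_rel (th V) e (rr _ (gx V)) hzx (rr _ (gz V))
      rw [he1] at this
      exact this
    have hzc := (th V).iseqv.symm hcz
    have hE : ∀ y : (F2 V).carrier, e3 (F2 V) (tsub (fun o : Option (algOn (F2 V) (th V)).carrier =>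
        o.elim (tsub ![tsub ![v0, v1] (rep v), tsub ![v0, v1] (rep u), e] d)
          (fun q => tsub ![v0, e] (rep q.1.2))) t) (gx V) y (gz V)
        = (F2 V).evalTrm (fun o : Option (algOn (F2 V) (th V)).carrier =>
        o.elim (e3 (F2 V) d ((F2 V).evalTrm ![gx V, y] (rep v))
          ((F2 V).evalTrm ![gx V, y] (rep u)) (e3 (F2 V) e (gx V) y (gz V)))
          (fun q => (F2 V).evalTrm ![gx V, e3 (F2 V) e (gx V) y (gz V)] (rep q.1.2))) t := by
      intro y
      unfold e3
      rw [eval_tsub]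
      congr 1
      funext o
      cases o with
      | none =>
        simp only [Option.elim]
        rw [ev_vec3, ev_vec2, ev_vec2]
        rfl
      | some q =>
        simp only [Option.elim]
        rw [ev_vec2]
        rfl
    refine ⟨_, (hE _).trans ?_, ?_⟩
    · rw [diag v hvz, diag u huz, he1, ← hz']
      rw [hor] at hz
      refine Eq.trans ?_ hz
      congr 1
      funext o
      cases o with
      | none => rfl
      | some q => exact rep2 _
    · rw [hE, rep2, rep2, ← hcc]
      have key := cent4 hN (tsub (fun o : Option (algOn (F2 V) (th V)).carrier => o.elim
          (tsub ![Trm.var (Sum.inl 0), .var (Sum.inl 1), .var (Sum.inl 2)] d)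
          (fun q => .var (Sum.inr q))) t : Trm σ (Fin 3 ⊕ (algOn (F2 V) (th V)).carrier))
        (Sum.elim ![u, u, cc] (fun q => (F2 V).evalTrm ![gx V, cc] (rep q.1.2)))
        (Sum.elim ![u, u, u] (fun q => q.1.1))
        (Sum.elim ![v, u, cc] (fun q => (F2 V).evalTrm ![gx V, cc] (rep q.1.2)))
        (Sum.elim ![v, u, u] (fun q => q.1.1))
        (by
          intro w
          rcases w with w | q
          · fin_cases w
            · exact Or.inl ⟨rfl, rfl, (th V).iseqv.trans huz ((th V).iseqv.symm hvz)⟩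
            · exact Or.inr ⟨rfl, rfl, rr _ _⟩
            · exact Or.inr ⟨rfl, rfl, (th V).iseqv.trans hcz ((th V).iseqv.symm huz)⟩
          · refine Or.inr ⟨rfl, rfl, ?_⟩
            show (th V).rel ((F2 V).evalTrm ![gx V, cc] (rep q.1.2)) q.1.1
            refine (th V).iseqv.trans (y := q.1.2) ?_ ((th V).iseqv.symm q.2)
            conv => arg 3; rw [← rep2 q.1.2]
            apply rel_eval
            intro i
            fin_cases i
            · exact rr _ _
            · exact hcz)
      have ev : ∀ (s m : (F2 V).carrier) (l : (algOn (F2 V) (th V)).carrier → (F2 V).carrier),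
          (F2 V).evalTrm (Sum.elim ![s, u, m] l)
          (tsub (fun o : Option (algOn (F2 V) (th V)).carrier => o.elim
          (tsub ![Trm.var (Sum.inl 0), .var (Sum.inl 1), .var (Sum.inl 2)] d)
          (fun q => .var (Sum.inr q))) t : Trm σ (Fin 3 ⊕ (algOn (F2 V) (th V)).carrier))
          = (F2 V).evalTrm (fun o : Option (algOn (F2 V) (th V)).carrier =>
            o.elim (e3 (F2 V) d s u m) l) t := by
        intro s m l
        rw [eval_tsub]
        congr 1
        funext o
        cases o with
        | none =>
          simp only [Option.elim]
          rw [ev_vec3]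
          rfl
        | some q => rfl
      rw [ev, ev, ev, ev] at key
      have huc := (th V).iseqv.trans huz hzc
      have hxc := (th V).iseqv.trans hxz hzc
      have id1 : (F2 V).evalTrm (fun o : Option (algOn (F2 V) (th V)).carrier =>
            o.elim (e3 (F2 V) d (gx V) (gx V) cc)
              (fun q => (F2 V).evalTrm ![gx V, cc] (rep q.1.2))) t = cc := by
        have fact : ∀ y : (F2 V).carrier, (F2 V).evalTrm ![gx V, y]
            (tsub (fun o : Option (algOn (F2 V) (th V)).carrier =>
              o.elim (tsub ![Trm.var 0, .var 0, .var 1] d) (fun q => rep q.1.2)) t)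
            = (F2 V).evalTrm (fun o : Option (algOn (F2 V) (th V)).carrier =>
            o.elim (e3 (F2 V) d (gx V) (gx V) y)
              (fun q => (F2 V).evalTrm ![gx V, y] (rep q.1.2))) t := by
          intro y
          rw [eval_tsub]
          congr 1
          funext o
          cases o with
          | none =>
            simp only [Option.elim]
            rw [ev_vec3]
            rfl
          | some q => rfl
        rw [← fact]
        refine (id2 (t := .var 1) ?_ hF (gx V) cc)
        rw [fact]
        rw [hor] at hz
        refine Eq.trans ?_ hz
        congr 1
        funext o
        cases o with
        | none => rfl
        | some q => exact rep2 _
      have key := key (by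
        rw [wd_idem h1 hF]
        refine (nn V).iseqv.trans ?_ he2
        conv => arg 3; rw [← id1]
        apply rel_eval
        intro o
        cases o with
        | none =>
          exact (nn V).iseqv.trans (wd_N h1 hF hN huc) ((nn V).iseqv.symm (wd_N h1 hF hN hxc))
        | some q => exact rr _ _)
      refine (nn V).iseqv.trans key ?_
      apply rel_eval
      intro o
      cases o with
      | none => exact wd_N2 h2 hF hN ((th V).iseqv.trans hvz ((th V).iseqv.symm huz))
      | some q => exact rr _ _

theorem ds_sat {V : Variety σ} {d : Trm σ (Fin 3)}
    (h1 : (nn V).rel (e3 (F2 V) d (gx V) (gx V) (gz V)) (gz V))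
    (h2 : (nn V).rel (e3 (F2 V) d (gx V) (gz V) (gz V)) (gx V))
    {a b : (algOn (F2 V) (th V)).carrier} (hab : (ds V d).rel a b)
    (hz : b.1.2 = gz V) (hK : Kd V a.1.1) : Kd V b.1.1 := by
  refine cg_sat (P := fun b : (algOn (F2 V) (th V)).carrier => b.1.2 = gz V → Kd V b.1.1) ?_ hab (fun _ => hK) hz
  intro a b hab t
  refine ⟨fun hP hz => ds_step h1 h2 a b hab t hz hP, fun hP hz => ds_step h1 h2 b a ?_ t hz hP⟩
  refine ⟨hab.1.symm, ?_⟩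
  rcases hab with ⟨h, k | k⟩
  · exact Or.inl ((nn V).iseqv.symm k)
  · exact Or.inr (h.symm.trans k)

/-! ### the algebra of triples -/

/-- triples -/
def trip (A : Alg σ) (α : Congruence A) : Alg σ where
  carrier := {p : A.carrier × A.carrier × A.carrier // α.rel p.1 p.2.1 ∧ α.rel p.1 p.2.2}
  interp f a := ⟨(A.interp f fun i => (a i).1.1, A.interp f fun i => (a i).1.2.1,
    A.interp f fun i => (a i).1.2.2),
    α.compat f _ _ fun i => (a i).2.1, α.compat f _ _ fun i => (a i).2.2⟩

theorem trip_mem {V : Variety σ} {A : Alg σ} (hA : V.Mem A) (α : Congruence A) :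
    V.Mem (trip A α) := by
  refine V.closed_sub (V.closed_prod (fun _ : Fin 3 => A) (fun _ => hA))
    ⟨⟨fun p i => ![p.1.1, p.1.2.1, p.1.2.2] i, ?_⟩, ?_⟩
  · intro f a
    funext i
    fin_cases i <;> rfl
  · intro p q h
    have e0 := congrFun h 0
    have e1 := congrFun h 1
    have e2 := congrFun h 2
    exact Subtype.ext (Prod.ext e0 (Prod.ext e1 e2))

/-- coordinates -/
def tu (A : Alg σ) (α : Congruence A) : UAHom (trip A α) A := ⟨fun p => p.1.1, fun _ _ => rfl⟩
/-- coordinates -/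
def tj (A : Alg σ) (α : Congruence A) : UAHom (trip A α) A := ⟨fun p => p.1.2.1, fun _ _ => rfl⟩
/-- coordinates -/
def tk (A : Alg σ) (α : Congruence A) : UAHom (trip A α) A := ⟨fun p => p.1.2.2, fun _ _ => rfl⟩
/-- coordinates -/
def tuj (A : Alg σ) (α : Congruence A) : UAHom (trip A α) (algOn A α) :=
  ⟨fun p => ⟨(p.1.1, p.1.2.1), p.2.1⟩, fun _ _ => rfl⟩
/-- coordinates -/
def tuk (A : Alg σ) (α : Congruence A) : UAHom (trip A α) (algOn A α) :=
  ⟨fun p => ⟨(p.1.1, p.1.2.2), p.2.2⟩, fun _ _ => rfl⟩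

end DC

namespace DC

variable {σ : Sig}

theorem exists_kd {V : Variety σ} (hD : CommLeftDistrib V ∨ CommRightDistrib V)
    {d : Trm σ (Fin 3)}
    (h1 : (nn V).rel (e3 (F2 V) d (gx V) (gx V) (gz V)) (gz V))
    (h2 : (nn V).rel (e3 (F2 V) d (gx V) (gz V) (gz V)) (gx V)) : Kd V (gx V) := by
  have hF := free_mem V (Fin 2)
  have hN := nn_cent V
  have hxz := th_xz V
  have hzx := (th V).iseqv.symm hxz
  have hzz := rr (th V) (gz V)
  set E := trip (F2 V) (th V) with hE
  have hEm : V.Mem E := trip_mem hF _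
  let ku : Congruence E := pull (tu (F2 V) (th V)) (eqc _)
  let kj : Congruence E := pull (tj (F2 V) (th V)) (eqc _)
  let kk : Congruence E := pull (tk (F2 V) (th V)) (eqc _)
  let Kj : Congruence E := pull (tuj (F2 V) (th V)) (ds V d)
  let Kk : Congruence E := pull (tuk (F2 V) (th V)) (ds V d)
  let H := kj ⊓ kk
  let PA := Kj ⊓ H
  let PB := Kk ⊓ H
  have uj : ku ⊓ kj ≤ Kj := by
    intro a b hab
    rw [inf_rel] at hab
    obtain ⟨k1, k2⟩ := hab
    have k1 : a.1.1 = b.1.1 := k1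
    have k2 : a.1.2.1 = b.1.2.1 := k2
    show (ds V d).rel ⟨(a.1.1, a.1.2.1), a.2.1⟩ ⟨(b.1.1, b.1.2.1), b.2.1⟩
    have : (⟨(a.1.1, a.1.2.1), a.2.1⟩ : (algOn (F2 V) (th V)).carrier)
      = ⟨(b.1.1, b.1.2.1), b.2.1⟩ := Subtype.ext (Prod.ext k1 k2)
    rw [this]
    exact rr _ _
  have uk : ku ⊓ kk ≤ Kk := by
    intro a b hab
    rw [inf_rel] at hab
    obtain ⟨k1, k2⟩ := hab
    have k1 : a.1.1 = b.1.1 := k1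
    have k2 : a.1.2.2 = b.1.2.2 := k2
    show (ds V d).rel ⟨(a.1.1, a.1.2.2), a.2.2⟩ ⟨(b.1.1, b.1.2.2), b.2.2⟩
    have : (⟨(a.1.1, a.1.2.2), a.2.2⟩ : (algOn (F2 V) (th V)).carrier)
      = ⟨(b.1.1, b.1.2.2), b.2.2⟩ := Subtype.ext (Prod.ext k1 k2)
    rw [this]
    exact rr _ _
  have Kjj : Kj ≤ kj := fun a b h => ds_le V d _ _ h
  -- the special elements
  have hz' : (th V).rel (gz V) (e3 (F2 V) d (gx V) (gx V) (gz V)) :=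
    (th V).iseqv.symm (nn_le V _ _ h1)
  let xzz : E.carrier := ⟨(gx V, gz V, gz V), hxz, hxz⟩
  let zzz : E.carrier := ⟨(gz V, gz V, gz V), hzz, hzz⟩
  -- membership criteria
  have inPA : ∀ a b : E.carrier, a.1.2.1 = b.1.2.1 → a.1.2.2 = b.1.2.2 →
      ((nn V).rel a.1.1 b.1.1 ∨ a.1.2.1 = e3 (F2 V) d (gx V) (gx V) (gz V)) → PA.rel a b := by
    intro a b k1 k2 k3
    rw [inf_rel, inf_rel]
    exact ⟨cg_of ⟨k1, k3⟩, k1, k2⟩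
  have inPB : ∀ a b : E.carrier, a.1.2.1 = b.1.2.1 → a.1.2.2 = b.1.2.2 →
      ((nn V).rel a.1.1 b.1.1 ∨ a.1.2.2 = e3 (F2 V) d (gx V) (gx V) (gz V)) → PB.rel a b := by
    intro a b k1 k2 k3
    rw [inf_rel, inf_rel]
    exact ⟨cg_of ⟨k2, k3⟩, k1, k2⟩
  have cu : ∀ a b c : E.carrier, (e3 E d a b c).1.1 = e3 (F2 V) d a.1.1 b.1.1 c.1.1 :=
    fun a b c => e3_hom (tu (F2 V) (th V)) d a b c
  have cj : ∀ a b c : E.carrier, (e3 E d a b c).1.2.1 = e3 (F2 V) d a.1.2.1 b.1.2.1 c.1.2.1 :=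
    fun a b c => e3_hom (tj (F2 V) (th V)) d a b c
  have ck : ∀ a b c : E.carrier, (e3 E d a b c).1.2.2 = e3 (F2 V) d a.1.2.2 b.1.2.2 c.1.2.2 :=
    fun a b c => e3_hom (tk (F2 V) (th V)) d a b c
  have idz := wd_idem h1 hF (gz V)
  -- final reduction
  have fin : (PA ⊔ PB).rel zzz xzz → Kd V (gx V) := by
    intro h
    have := sup_sat (P := fun a : E.carrier => a.1.2.1 = gz V ∧ a.1.2.2 = gz V ∧ Kd V a.1.1)
      ?_ ?_ h ⟨rfl, rfl, v2, rfl, rr _ _⟩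
    · exact this.2.2
    · rintro a b hab ⟨j, k, K⟩
      rw [inf_rel, inf_rel] at hab
      obtain ⟨l1, l2, l3⟩ := hab
      have l2 : a.1.2.1 = b.1.2.1 := l2
      have l3 : a.1.2.2 = b.1.2.2 := l3
      refine ⟨l2.symm.trans j, l3.symm.trans k, ?_⟩
      have l1 : (ds V d).rel ⟨(a.1.1, a.1.2.1), a.2.1⟩ ⟨(b.1.1, b.1.2.1), b.2.1⟩ := l1
      exact ds_sat h1 h2 l1 (l2.symm.trans j) K
    · rintro a b hab ⟨j, k, K⟩
      rw [inf_rel, inf_rel] at hab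
      obtain ⟨l1, l2, l3⟩ := hab
      have l2 : a.1.2.1 = b.1.2.1 := l2
      have l3 : a.1.2.2 = b.1.2.2 := l3
      refine ⟨l2.symm.trans j, l3.symm.trans k, ?_⟩
      have l1 : (ds V d).rel ⟨(a.1.1, a.1.2.2), a.2.2⟩ ⟨(b.1.1, b.1.2.2), b.2.2⟩ := l1
      exact ds_sat h1 h2 l1 (l3.symm.trans k) K
  -- the last bit of both matrix arguments
  have nrm : ∀ a : E.carrier, a.1.2.1 = gz V → a.1.2.2 = gz V → (th V).rel (gz V) a.1.1 →
      (PA ⊓ PB).rel (e3 E d zzz zzz a) a := by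
    intro a k1 k2 k3
    have n1 : (nn V).rel (e3 E d zzz zzz a).1.1 a.1.1 := by
      rw [cu]
      exact wd_N h1 hF hN k3
    have n2 : (e3 E d zzz zzz a).1.2.1 = a.1.2.1 := by
      rw [cj, k1]
      exact idz
    have n3 : (e3 E d zzz zzz a).1.2.2 = a.1.2.2 := by
      rw [ck, k2]
      exact idz
    rw [inf_rel]
    exact ⟨inPA _ _ n2 n3 (Or.inl n1), inPB _ _ n2 n3 (Or.inl n1)⟩
  have nz := nrm zzz rfl rfl hzz
  have nx := nrm xzz rfl rfl hzx
  apply fin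
  rcases hD with hD | hD
  · obtain ⟨Q, q1, q2, q3⟩ := stepA_left hD hEm (PA ⊓ PB) ((ku ⊓ kk) ⊔ (PA ⊓ PB))
      ((ku ⊓ kj) ⊔ (PA ⊓ PB)) H PB PA le_sup_right le_sup_right
      (inf_le_left.trans inf_le_right) inf_le_right inf_le_left
      (cent_inf (cent_left (sup_le uk (inf_le_right.trans inf_le_left))) (cent_right le_rfl))
      (cent_inf (cent_left (sup_le uj (inf_le_left.trans inf_le_left))) (cent_right le_rfl))
    let zxx : E.carrier := ⟨(gz V, gx V, gx V), hzx, hzx⟩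
    let zzx : E.carrier := ⟨(gz V, gz V, gx V), hzz, hzx⟩
    have row : ((ku ⊓ kk) ⊔ (PA ⊓ PB) ⊔ ((ku ⊓ kj) ⊔ (PA ⊓ PB))).rel zxx zzz := by
      refine Congruence.iseqv _ |>.trans (y := zzx) (sup_l _ _ (sup_l _ _ ?_))
        (sup_r _ _ (sup_l _ _ ?_))
      · rw [inf_rel]; exact ⟨rfl, rfl⟩
      · rw [inf_rel]; exact ⟨rfl, rfl⟩
    have col : H.rel zzz xzz := by
      rw [inf_rel]; exact ⟨rfl, rfl⟩
    have key := cent_e3 q3 (cp d v0 v0 v1) row col (rr H zzz)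
    simp only [e3_cp, e3_v0, e3_v1] at key
    have key := key (q1 _ _ (by
      have n2 : (e3 E d zxx zxx zzz).1.2.1 = (e3 E d zxx zxx xzz).1.2.1 := by rw [cj, cj]
      have n3 : (e3 E d zxx zxx zzz).1.2.2 = (e3 E d zxx zxx xzz).1.2.2 := by rw [ck, ck]
      rw [inf_rel]
      exact ⟨inPA _ _ n2 n3 (Or.inr (cj _ _ _)), inPB _ _ n2 n3 (Or.inr (ck _ _ _))⟩))
    have := Q.iseqv.trans (Q.iseqv.symm (q1 _ _ nz)) (Q.iseqv.trans key (q1 _ _ nx))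
    have := q2 _ _ this
    rwa [sup_comm] at this
  · have PAk : PA ≤ kk := inf_le_right.trans inf_le_right
    obtain ⟨Q, q1, q2, q3⟩ := stepA_right hD hEm PA kk ((ku ⊓ kj) ⊔ PA) (PA ⊔ PB)
      (kk ⊓ ((ku ⊓ kj) ⊔ PA)) (PA ⊔ PB) le_sup_right le_sup_left PAk
      (le_inf PAk le_sup_right) le_sup_left (cent_meet _ _) (cent_right le_rfl)
    have q4 : Q ≤ PA ⊔ PB := by
      refine q2.trans (sup_le ?_ le_rfl)
      refine le_trans ?_ le_sup_left
      have l1 : (ku ⊓ kj) ⊔ PA ≤ Kj := sup_le uj inf_le_left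
      exact le_inf (inf_le_right.trans l1) (le_inf ((inf_le_right.trans l1).trans Kjj) inf_le_left)
    let zxz : E.carrier := ⟨(gz V, gx V, gz V), hzx, hzz⟩
    let xzp : E.carrier := ⟨(gx V, gz V, e3 (F2 V) d (gx V) (gx V) (gz V)), hxz,
      (th V).iseqv.trans hxz hz'⟩
    let zzp : E.carrier := ⟨(gz V, gz V, e3 (F2 V) d (gx V) (gx V) (gz V)), hzz, hz'⟩
    have row : kk.rel zxz zzz := rfl
    have col : ((ku ⊓ kj) ⊔ PA ⊔ (PA ⊔ PB)).rel zzz xzz := by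
      refine Congruence.iseqv _ |>.trans (y := zzp) (sup_l _ _ (sup_l _ _ ?_)) ?_
      · rw [inf_rel]; exact ⟨rfl, rfl⟩
      · refine Congruence.iseqv _ |>.trans (y := xzp) (sup_r _ _ (sup_r _ _ ?_))
          (sup_l _ _ (sup_l _ _ ?_))
        · exact inPB _ _ rfl rfl (Or.inr rfl)
        · rw [inf_rel]; exact ⟨rfl, rfl⟩
    have key := cent_e3 q3 (cp d v0 v0 v1) row col (rr _ zzz)
    simp only [e3_cp, e3_v0, e3_v1] at key
    have key := key (q1 _ _ (by
      have n2 : (e3 E d zxz zxz zzz).1.2.1 = (e3 E d zxz zxz xzz).1.2.1 := by rw [cj, cj]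
      have n3 : (e3 E d zxz zxz zzz).1.2.2 = (e3 E d zxz zxz xzz).1.2.2 := by rw [ck, ck]
      exact inPA _ _ n2 n3 (Or.inr (cj _ _ _))))
    rw [inf_rel] at nz nx
    exact q4 _ _ (Q.iseqv.trans (Q.iseqv.symm (q1 _ _ nz.1)) (Q.iseqv.trans key (q1 _ _ nx.1)))

theorem comm_half {V : Variety σ} {e : Trm σ (Fin 3)}
    (h1 : e3 (F2 V) e (gx V) (gx V) (gz V) = gz V)
    (h2 : (nn V).rel (e3 (F2 V) e (gx V) (gz V) (gz V)) (gx V))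
    {A : Alg σ} (hA : V.Mem A) (α β : Congruence A) : commC β α ≤ commC α β := by
  apply comm_le
  set δ := commC α β with hδ
  have hc : Centralizes α β δ := cent_comm α β
  have hle : δ ≤ α ⊓ β := comm_le (cent_meet α β)
  have hcm : Centralizes (α ⊓ β) (α ⊓ β) δ := cent_mono hc inf_le_left inf_le_right
  have ex : ∀ a b : A.carrier, e3 A e a a b = b := by
    intro a b
    have := id2 (V := V) (s := tsub ![.var 0, .var 0, .var 1] e) (t := .var 1)
      (by rw [ev_vec3]; exact h1) hA a b
    rw [ev_vec3] at this
    exact this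
  intro m n t u v a b huv hab hpr
  -- rows `u → v` are in β, columns `a → b` are in α
  let W := Fin n ⊕ (Fin m ⊕ (Fin n ⊕ Fin m))
  let t1 : Trm σ W := tsub (Sum.elim (fun i => .var (.inr (.inl i))) (fun j => .var (.inl j))) t
  let t2 : Trm σ W := tsub (Sum.elim (fun i => .var (.inr (.inl i)))
    (fun j => .var (.inr (.inr (.inl j))))) t
  let t3 : Trm σ W := tsub (Sum.elim (fun i => .var (.inr (.inr (.inr i))))
    (fun j => .var (.inr (.inr (.inl j))))) t
  have ev : ∀ (x : Fin n → A.carrier) (y : Fin m → A.carrier),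
      A.evalTrm (Sum.elim x (Sum.elim y (Sum.elim b v))) (tsub ![t1, t2, t3] e)
      = e3 A e (A.evalTrm (Sum.elim y x) t) (A.evalTrm (Sum.elim y b) t)
        (A.evalTrm (Sum.elim v b) t) := by
    intro x y
    rw [ev_vec3]
    have a1 : A.evalTrm (Sum.elim x (Sum.elim y (Sum.elim b v))) t1
        = A.evalTrm (Sum.elim y x) t := by
      simp only [t1, eval_tsub]
      congr 1
      funext o; cases o <;> rfl
    have a2 : A.evalTrm (Sum.elim x (Sum.elim y (Sum.elim b v))) t2
        = A.evalTrm (Sum.elim y b) t := by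
      simp only [t2, eval_tsub]
      congr 1
      funext o; cases o <;> rfl
    have a3 : A.evalTrm (Sum.elim x (Sum.elim y (Sum.elim b v))) t3
        = A.evalTrm (Sum.elim v b) t := by
      simp only [t3, eval_tsub]
      congr 1
      funext o; cases o <;> rfl
    rw [a1, a2, a3]
    rfl
  have key := cent4 hc (tsub ![t1, t2, t3] e)
    (Sum.elim b (Sum.elim u (Sum.elim b v))) (Sum.elim b (Sum.elim v (Sum.elim b v)))
    (Sum.elim a (Sum.elim u (Sum.elim b v))) (Sum.elim a (Sum.elim v (Sum.elim b v)))
    (by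
      rintro (j | i | j | i)
      · exact Or.inl ⟨rfl, rfl, α.iseqv.symm (hab j)⟩
      · exact Or.inr ⟨rfl, rfl, huv i⟩
      · exact Or.inr ⟨rfl, rfl, rr _ _⟩
      · exact Or.inr ⟨rfl, rfl, rr _ _⟩)
  rw [ev, ev, ev, ev, ex, ex] at key
  have key := key (rr _ _)
  set p := A.evalTrm (Sum.elim u a) t
  set r := A.evalTrm (Sum.elim u b) t
  set q := A.evalTrm (Sum.elim v a) t
  set s := A.evalTrm (Sum.elim v b) t
  have k1 : δ.rel (e3 A e p r s) s := by
    have := e3_rel δ e (rr _ p) (δ.iseqv.symm hpr) (rr _ s)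
    rwa [ex] at this
  have qa : α.rel q s := rel_eval α _ _ (fun o => by
    cases o with
    | inl i => exact rr _ _
    | inr j => exact hab j) t
  have pq : β.rel p q := rel_eval β _ _ (fun o => by
    cases o with
    | inl i => exact huv i
    | inr j => exact rr _ _) t
  have rs : β.rel r s := rel_eval β _ _ (fun o => by
    cases o with
    | inl i => exact huv i
    | inr j => exact rr _ _) t
  have prb : β.rel p r := ((inf_rel α β p r).1 (hle _ _ hpr)).2
  have qb : β.rel q s := β.iseqv.trans (β.iseqv.symm pq) (β.iseqv.trans prb rs)
  have k2 := wd_N2 h2 hA hcm ((inf_rel α β q s).2 ⟨qa, qb⟩)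
  exact δ.iseqv.trans (δ.iseqv.symm k2) (δ.iseqv.trans (δ.iseqv.symm key) k1)

theorem dist_comm {V : Variety σ} (hT : HasTaylorTrm V)
    (hD : CommLeftDistrib V ∨ CommRightDistrib V) : CommutativeCommutator V := by
  obtain ⟨d, h1, h2⟩ := exists_wd hD hT
  obtain ⟨e, k1, k2⟩ := exists_kd hD h1 h2
  intro A hA x y
  exact le_antisymm (comm_half k1 k2 hA y x) (comm_half k1 k2 hA x y)

end DC

/-- If a variety `V` has a Taylor term, then the commutator is left
distributive in `V` iff it is right distributive in `V`; and if either
distributivity condition holds then the commutator is commutative in `V`. -/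
theorem dist_implies_comm {σ : Sig} (V : Variety σ) (hT : HasTaylorTrm V) :
    (CommLeftDistrib V ↔ CommRightDistrib V) ∧
    ((CommLeftDistrib V ∨ CommRightDistrib V) → CommutativeCommutator V) := by
  have hc := fun hD => DC.dist_comm (V := V) hT hD
  refine ⟨⟨fun h A hA x y z => ?_, fun h A hA x y z => ?_⟩, hc⟩
  · have k := hc (Or.inl h) A hA
    rw [k x (y ⊔ z), k x y, k x z]
    exact h A hA y z x
  · have k := hc (Or.inr h) A hA
    rw [k (x ⊔ y) z, k x z, k y z]
    exact h A hA z x y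
end
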